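/- arXiv:2503.09825 — 3 statements merged into one kernel-verified Lean document; each statement's English description precedes it below -/
import Mathlib

section
/- There exists a unique probability measure F* in the feasible set Ω that achieves the capacity, i.e., I(F*) = sup_{F ∈ Ω} I(F) = C (assuming Ω is nonempty and C is finite). In particular the supremum of the mutual information over Ω is attained, and the maximizer is unique. -/
open MeasureTheory ProbabilityTheory Real ENNReal NNReal

noncomputable section
open scoped Classical

/-- Kullback–Leibler divergence `D_KL(μ ‖ ν)` with values in `ℝ≥0∞`:
`∫ log (dμ/dν) dμ` when `μ ≪ ν` (and the log-likelihood ratio is integrable),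
and `+∞` otherwise. -/
def klDiv' (μ ν : Measure ℝ) : ℝ≥0∞ :=
  if μ ≪ ν ∧ Integrable (llr μ ν) μ then ENNReal.ofReal (∫ y, llr μ ν y ∂μ) else ⊤

/-- The law `κ(x)` of the channel output `Y = K·x·e^{2G} + N`, where
`G ~ N(m, s²)` and `N ~ N(0, sg²)` are independent real Gaussians. -/
def channelLaw (K m s sg : ℝ) (x : ℝ) : Measure ℝ :=
  Measure.map (fun p : ℝ × ℝ => K * x * Real.exp (2 * p.1) + p.2)
    ((gaussianReal m (Real.toNNReal (s ^ 2))).prod (gaussianReal 0 (Real.toNNReal (sg ^ 2))))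

/-- The output distribution `P_F = ∫ κ(x) dF(x)`. -/
def outputDist (K m s sg : ℝ) (F : Measure ℝ) : Measure ℝ :=
  F.bind (channelLaw K m s sg)

/-- The marginal information density `i(x; F) = D_KL(κ(x) ‖ P_F)`. -/
def infoDensity (K m s sg : ℝ) (F : Measure ℝ) (x : ℝ) : ℝ≥0∞ :=
  klDiv' (channelLaw K m s sg x) (outputDist K m s sg F)

/-- The mutual information `I(F) = ∫ i(x; F) dF(x) ∈ [0, ∞]`. -/
def mutualInfo (K m s sg : ℝ) (F : Measure ℝ) : ℝ≥0∞ :=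
  ∫⁻ x, infoDensity K m s sg F x ∂F

/-- Membership in the feasible set `Ω`: `F` is a probability measure on `[0, A]`
with `∫ x dF ≤ ε` and `∫ b·x·ln(1 + c·x) dF ≥ E_th`. -/
def feasible (A ε b c Eth : ℝ) (F : Measure ℝ) : Prop :=
  IsProbabilityMeasure F ∧ F (Set.Icc 0 A)ᶜ = 0 ∧
    (∫ x, x ∂F) ≤ ε ∧ Eth ≤ ∫ x, b * x * Real.log (1 + c * x) ∂F

/-- The capacity `C = sup_{F ∈ Ω} I(F)`. -/
def capacity (K m s sg A ε b c Eth : ℝ) : ℝ≥0∞ :=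
  ⨆ F ∈ {F : Measure ℝ | feasible A ε b c Eth F}, mutualInfo K m s sg F


/-- Two-sided bounds on a positive measurable density. -/
structure Good (B c a : ℝ) (u : ℝ → ℝ) : Prop where
  meas : Measurable u
  up : ∀ y, u y ≤ B * ((1 + y ^ 2) ^ 2)⁻¹
  low : ∀ y, c * rexp (-(a * y ^ 2)) ≤ u y

lemma Good.pos {B c a : ℝ} {u : ℝ → ℝ} (hc : 0 < c) (h : Good B c a u) (y : ℝ) : 0 < u y :=
  lt_of_lt_of_le (by positivity) (h.low y)

lemma Good.abs_log_le {B c a : ℝ} {u : ℝ → ℝ} (hc : 0 < c) (h : Good B c a u) (y : ℝ) :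
    |Real.log (u y)| ≤ (|Real.log c| + |a| + |Real.log B|) * (1 + y ^ 2) := by
  have hp := h.pos hc y
  have hB : 0 < B := by
    have h1 := h.up y
    by_contra hB
    have : B * ((1 + y ^ 2) ^ 2)⁻¹ ≤ 0 := mul_nonpos_of_nonpos_of_nonneg (not_lt.mp hB) (by positivity)
    linarith
  have h1 : Real.log c - a * y ^ 2 ≤ Real.log (u y) := by
    have := Real.log_le_log (by positivity) (h.low y)
    rw [Real.log_mul hc.ne' (Real.exp_pos _).ne', Real.log_exp] at this
    linarith
  have h2 : Real.log (u y) ≤ Real.log B := by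
    apply Real.log_le_log hp
    refine (h.up y).trans ?_
    have : ((1 + y ^ 2) ^ 2)⁻¹ ≤ 1 := by
      apply inv_le_one_of_one_le₀
      nlinarith [sq_nonneg y]
    nlinarith
  have e1 := neg_abs_le (Real.log c)
  have e2 := le_abs_self a
  have e3 := le_abs_self (Real.log B)
  have e4 := abs_nonneg (Real.log c)
  have e5 := abs_nonneg (Real.log B)
  have e6 := abs_nonneg a
  have e7 := sq_nonneg y
  rw [abs_le]
  constructor <;> nlinarith [mul_nonneg e4 e7, mul_nonneg e5 e7, mul_nonneg e6 e7, mul_le_mul_of_nonneg_right e2 e7]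

/-- The dominating constant. -/
def LC (B c a : ℝ) : ℝ := B * (|Real.log c| + |a| + |Real.log B|)

lemma Good.dom {B c a : ℝ} {u p : ℝ → ℝ} (hc : 0 < c) (hu : Good B c a u) (hp : Good B c a p)
    (y : ℝ) : ‖u y * Real.log (p y)‖ ≤ LC B c a * (1 + y ^ 2)⁻¹ := by
  rw [norm_mul, Real.norm_eq_abs, Real.norm_eq_abs, abs_of_pos (hu.pos hc y)]
  have h1 := hu.up y
  have h2 := hp.abs_log_le hc y
  calc u y * |Real.log (p y)| ≤ (B * ((1 + y ^ 2) ^ 2)⁻¹) * ((|Real.log c| + |a| + |Real.log B|) * (1 + y ^ 2)) := by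
        apply mul_le_mul h1 h2 (abs_nonneg _)
        exact (hu.pos hc y).le.trans h1
    _ = _ := by
        unfold LC
        have : (1 + y ^ 2) ≠ 0 := by positivity
        field_simp

lemma Good.integrable_mul_log {B c a : ℝ} {u p : ℝ → ℝ} (hc : 0 < c) (hu : Good B c a u)
    (hp : Good B c a p) : Integrable (fun y => u y * Real.log (p y)) := by
  refine (integrable_inv_one_add_sq.const_mul (LC B c a)).mono' ?_ (.of_forall (hu.dom hc hp))
  exact (hu.meas.mul hp.meas.log).aestronglyMeasurable

lemma Good.integrable {B c a : ℝ} {u : ℝ → ℝ} (hc : 0 < c) (hu : Good B c a u) : Integrable u := by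
  refine (integrable_inv_one_add_sq.const_mul B).mono' hu.meas.aestronglyMeasurable (.of_forall fun y => ?_)
  have h0 := hu.pos hc y
  have h1 := hu.up y
  rw [Real.norm_eq_abs, abs_of_pos h0]
  have hB : 0 < B := by
    by_contra hB
    have : B * ((1 + y ^ 2) ^ 2)⁻¹ ≤ 0 := mul_nonpos_of_nonpos_of_nonneg (not_lt.mp hB) (by positivity)
    linarith
  refine h1.trans ?_
  gcongr
  nlinarith [sq_nonneg y]

/-- KL divergence of two densities. -/
def klR (u p : ℝ → ℝ) : ℝ := (∫ y, u y * Real.log (u y)) - ∫ y, u y * Real.log (p y)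

lemma klR_nonneg {B c a : ℝ} {u p : ℝ → ℝ} (hc : 0 < c) (hu : Good B c a u)
    (hp : Good B c a p) (h1 : ∫ y, u y = 1) (h2 : ∫ y, p y = 1) : 0 ≤ klR u p := by
  unfold klR
  rw [← integral_sub (hu.integrable_mul_log hc hu) (hu.integrable_mul_log hc hp)]
  have : ∫ y, (u y - p y) = 0 := by
    rw [integral_sub (hu.integrable hc) (hp.integrable hc), h1, h2, sub_self]
  rw [← this]
  apply integral_mono ((hu.integrable hc).sub (hp.integrable hc))
    ((hu.integrable_mul_log hc hu).sub (hu.integrable_mul_log hc hp))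
  intro y
  have e1 := hu.pos hc y
  have e2 := hp.pos hc y
  have e3 := Real.log_le_sub_one_of_pos (div_pos e2 e1)
  rw [Real.log_div e2.ne' e1.ne'] at e3
  have e4 := mul_le_mul_of_nonneg_left e3 e1.le
  have e5 : u y * (p y / u y - 1) = p y - u y := by field_simp
  simp only [Pi.sub_apply]
  linarith

lemma klDiv'_withDensity {B c a : ℝ} {u p : ℝ → ℝ} (hc : 0 < c) (hu : Good B c a u)
    (hp : Good B c a p) :
    klDiv' (volume.withDensity fun y => ENNReal.ofReal (u y))
      (volume.withDensity fun y => ENNReal.ofReal (p y)) = ENNReal.ofReal (klR u p) := by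
  set P := (volume : Measure ℝ).withDensity fun y => ENNReal.ofReal (p y) with hP
  have mp : Measurable fun y => ENNReal.ofReal (p y) := hp.meas.ennreal_ofReal
  have mu : Measurable fun y => ENNReal.ofReal (u y) := hu.meas.ennreal_ofReal
  have mq : Measurable fun y => ENNReal.ofReal (u y / p y) := (hu.meas.div hp.meas).ennreal_ofReal
  have hPfin : IsFiniteMeasure P := by
    apply isFiniteMeasure_withDensity_ofReal
    exact (hp.integrable hc).2
  have hU : (volume.withDensity fun y => ENNReal.ofReal (u y)) =
      P.withDensity fun y => ENNReal.ofReal (u y / p y) := by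
    rw [hP, ← withDensity_mul _ mp mq]
    congr 1
    ext y
    rw [Pi.mul_apply, ← ENNReal.ofReal_mul (hp.pos hc y).le, mul_div_cancel₀ _ (hp.pos hc y).ne']
  have hac : (volume.withDensity fun y => ENNReal.ofReal (u y)) ≪ P := by
    rw [hU]; exact withDensity_absolutelyContinuous _ _
  have hllr : llr (volume.withDensity fun y => ENNReal.ofReal (u y)) P =ᵐ[volume.withDensity fun y => ENNReal.ofReal (u y)]
      fun y => Real.log (u y) - Real.log (p y) := by
    apply hac.ae_le
    have := Measure.rnDeriv_withDensity P mq
    rw [← hU] at this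
    filter_upwards [this] with y hy
    rw [llr, hy, ENNReal.toReal_ofReal (div_pos (hu.pos hc y) (hp.pos hc y)).le,
      Real.log_div (hu.pos hc y).ne' (hp.pos hc y).ne']
  have hIntL : Integrable (fun y => Real.log (u y) - Real.log (p y))
      (volume.withDensity fun y => ENNReal.ofReal (u y)) := by
    rw [integrable_withDensity_iff_integrable_smul₀' mu.aemeasurable (by simp)]
    have := (hu.integrable_mul_log hc hu).sub (hu.integrable_mul_log hc hp)
    refine this.congr (.of_forall fun y => ?_)
    simp [ENNReal.toReal_ofReal (hu.pos hc y).le, mul_sub]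
  rw [klDiv', if_pos ⟨hac, (integrable_congr hllr).2 hIntL⟩, integral_congr_ae hllr,
    integral_withDensity_eq_integral_toReal_smul mu (by simp), klR,
    ← integral_sub (hu.integrable_mul_log hc hu) (hu.integrable_mul_log hc hp)]
  congr 2
  ext y
  simp [ENNReal.toReal_ofReal (hu.pos hc y).le, mul_sub]
set_option linter.unusedSectionVars false

section abstractKernel

variable {X : Type*} [MetricSpace X] [CompactSpace X] [MeasurableSpace X] [BorelSpace X]

/-- A kernel density with uniform bounds. -/
structure GoodK (B c a : ℝ) (k : X → ℝ → ℝ) : Prop where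
  meas : Measurable (Function.uncurry k)
  cont : ∀ y, Continuous fun x => k x y
  good : ∀ x, Good B c a (k x)
  one : ∀ x, ∫ y, k x y = 1

/-- Output density. -/
def pOut (k : X → ℝ → ℝ) (Q : Measure X) (y : ℝ) : ℝ := ∫ x, k x y ∂Q

/-- Negative conditional entropy. -/
def gFun (k : X → ℝ → ℝ) (x : X) : ℝ := ∫ y, k x y * Real.log (k x y)

/-- Mutual information in entropy form. -/
def JFun (k : X → ℝ → ℝ) (Q : Measure X) : ℝ :=
  (∫ x, gFun k x ∂Q) - ∫ y, pOut k Q y * Real.log (pOut k Q y)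

variable {B c a : ℝ} {k : X → ℝ → ℝ}

lemma integrable_of_cont {f : X → ℝ} (hf : Continuous f) (Q : Measure X) [IsFiniteMeasure Q] :
    Integrable f Q :=
  hf.integrable_of_hasCompactSupport (HasCompactSupport.of_compactSpace f)

lemma GoodK.good_pOut (h : GoodK B c a k) (Q : Measure X) [IsProbabilityMeasure Q] :
    Good B c a (pOut k Q) where
  meas := by
    have := (h.meas.stronglyMeasurable.integral_prod_left (μ := Q)).measurable
    exact this
  up y := by
    have : ∫ x, k x y ∂Q ≤ ∫ x, B * ((1 + y ^ 2) ^ 2)⁻¹ ∂Q :=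
      integral_mono (integrable_of_cont (h.cont y) Q) (integrable_const _) fun x => (h.good x).up y
    simpa [pOut] using this
  low y := by
    have : ∫ x, c * rexp (-(a * y ^ 2)) ∂Q ≤ ∫ x, k x y ∂Q :=
      integral_mono (integrable_const _) (integrable_of_cont (h.cont y) Q) fun x => (h.good x).low y
    simpa [pOut] using this

lemma GoodK.continuous_gFun (hc : 0 < c) (h : GoodK B c a k) : Continuous (gFun k) := by
  refine continuous_of_dominated (bound := fun y => LC B c a * (1 + y ^ 2)⁻¹) ?_ ?_ ?_ ?_
  · intro x
    exact ((h.good x).meas.mul (h.good x).meas.log).aestronglyMeasurable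
  · intro x
    exact .of_forall fun y => (h.good x).dom hc (h.good x) y
  · exact integrable_inv_one_add_sq.const_mul _
  · exact .of_forall fun y => Real.continuous_mul_log.comp (h.cont y)

lemma GoodK.continuous_JFun (hc : 0 < c) (h : GoodK B c a k) :
    Continuous fun Q : ProbabilityMeasure X => JFun k (Q : Measure X) := by
  unfold JFun
  apply Continuous.sub
  · exact ProbabilityMeasure.continuous_integral_continuousMap (⟨gFun k, h.continuous_gFun hc⟩ : C(X, ℝ))
  · refine continuous_of_dominated (bound := fun y => LC B c a * (1 + y ^ 2)⁻¹) ?_ ?_ ?_ ?_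
    · intro Q
      exact ((h.good_pOut (Q : Measure X)).meas.mul (h.good_pOut (Q : Measure X)).meas.log).aestronglyMeasurable
    · intro Q
      exact .of_forall fun y => (h.good_pOut (Q : Measure X)).dom hc (h.good_pOut (Q : Measure X)) y
    · exact integrable_inv_one_add_sq.const_mul _
    · refine .of_forall fun y => Real.continuous_mul_log.comp ?_
      exact ProbabilityMeasure.continuous_integral_continuousMap (⟨fun x => k x y, h.cont y⟩ : C(X, ℝ))

lemma GoodK.integrable_prod (hc : 0 < c) (h : GoodK B c a k) (Q : Measure X)
    [IsProbabilityMeasure Q] {p : ℝ → ℝ} (hp : Good B c a p) :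
    Integrable (fun z : X × ℝ => k z.1 z.2 * Real.log (p z.2)) (Q.prod volume) := by
  have h1 : Integrable (fun z : X × ℝ => (1 : ℝ) * (LC B c a * (1 + z.2 ^ 2)⁻¹)) (Q.prod volume) :=
    (integrable_const (1 : ℝ)).mul_prod (integrable_inv_one_add_sq.const_mul (LC B c a))
  refine h1.mono' ?_ (.of_forall fun z => ?_)
  · exact (h.meas.mul (hp.meas.log.comp measurable_snd)).aestronglyMeasurable
  · rw [one_mul]
    exact (h.good z.1).dom hc hp z.2

lemma GoodK.integrable_prod' (hc : 0 < c) (h : GoodK B c a k) (Q : Measure X)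
    [IsProbabilityMeasure Q] :
    Integrable (fun z : X × ℝ => k z.1 z.2) (Q.prod volume) := by
  have h1 : Integrable (fun z : X × ℝ => (1 : ℝ) * (B * (1 + z.2 ^ 2)⁻¹)) (Q.prod volume) :=
    (integrable_const (1 : ℝ)).mul_prod (integrable_inv_one_add_sq.const_mul B)
  refine h1.mono' h.meas.aestronglyMeasurable (.of_forall fun z => ?_)
  have h0 := (h.good z.1).pos hc z.2
  have h1 := (h.good z.1).up z.2
  rw [Real.norm_eq_abs, abs_of_pos h0, one_mul]
  have hB : 0 < B := by
    by_contra hB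
    have : B * ((1 + z.2 ^ 2) ^ 2)⁻¹ ≤ 0 :=
      mul_nonpos_of_nonpos_of_nonneg (not_lt.mp hB) (by positivity)
    linarith
  refine h1.trans ?_
  gcongr
  nlinarith [sq_nonneg z.2]

lemma GoodK.integral_pOut (hc : 0 < c) (h : GoodK B c a k) (Q : Measure X)
    [IsProbabilityMeasure Q] : ∫ y, pOut k Q y = 1 := by
  unfold pOut
  rw [← integral_integral_swap (f := fun x y => k x y) (h.integrable_prod' hc Q)]
  simp [h.one]

lemma GoodK.integral_klR (hc : 0 < c) (h : GoodK B c a k) (Q : Measure X)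
    [IsProbabilityMeasure Q] :
    Integrable (fun x => klR (k x) (pOut k Q)) Q ∧ ∫ x, klR (k x) (pOut k Q) ∂Q = JFun k Q := by
  have h1 := h.integrable_prod hc Q (h.good_pOut Q)
  have h2 : Integrable (fun x => ∫ y, k x y * Real.log (k x y)) Q :=
    integrable_of_cont (h.continuous_gFun hc) Q
  have h3 : Integrable (fun x => ∫ y, k x y * Real.log (pOut k Q y)) Q := h1.integral_prod_left
  refine ⟨h2.sub h3, ?_⟩
  unfold klR JFun
  rw [integral_sub h2 h3]
  congr 1
  rw [integral_integral_swap (f := fun x y => k x y * Real.log (pOut k Q y)) h1]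
  congr 1
  ext y
  rw [integral_mul_const]
  rfl

lemma GoodK.lintegral_klR (hc : 0 < c) (h : GoodK B c a k) (Q : Measure X)
    [IsProbabilityMeasure Q] :
    ∫⁻ x, ENNReal.ofReal (klR (k x) (pOut k Q)) ∂Q = ENNReal.ofReal (JFun k Q) ∧ 0 ≤ JFun k Q := by
  obtain ⟨h1, h2⟩ := h.integral_klR hc Q
  have h3 : ∀ x, 0 ≤ klR (k x) (pOut k Q) := fun x =>
    klR_nonneg hc (h.good x) (h.good_pOut Q) (h.one x) (h.integral_pOut hc Q)
  rw [← h2]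
  exact ⟨(ofReal_integral_eq_lintegral_ofReal h1 (.of_forall h3)).symm, integral_nonneg h3⟩

/-- The midpoint of two measures. -/
def midM {Y : Type*} [MeasurableSpace Y] (Q S : Measure Y) : Measure Y := (2⁻¹ : ℝ≥0∞) • Q + (2⁻¹ : ℝ≥0∞) • S

instance {Y : Type*} [MeasurableSpace Y] (Q S : Measure Y) [IsProbabilityMeasure Q] [IsProbabilityMeasure S] :
    IsProbabilityMeasure (midM Q S) := by
  constructor
  simp [midM, ENNReal.inv_two_add_inv_two]

lemma integral_midM {Y : Type*} [MeasurableSpace Y] (Q S : Measure Y) {f : Y → ℝ} (h1 : Integrable f Q)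
    (h2 : Integrable f S) : ∫ x, f x ∂(midM Q S) = ((∫ x, f x ∂Q) + ∫ x, f x ∂S) / 2 := by
  unfold midM
  rw [integral_add_measure (h1.smul_measure (by simp)) (h2.smul_measure (by simp)),
    integral_smul_measure, integral_smul_measure]
  simp
  ring

lemma GoodK.strict (hc : 0 < c) (h : GoodK B c a k) (Q S : Measure X)
    [IsProbabilityMeasure Q] [IsProbabilityMeasure S]
    (hJ : JFun k (midM Q S) ≤ (JFun k Q + JFun k S) / 2) :
    pOut k Q =ᵐ[volume] pOut k S := by
  have hp : ∀ y, pOut k (midM Q S) y = (pOut k Q y + pOut k S y) / 2 := fun y =>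
    integral_midM Q S (integrable_of_cont (h.cont y) Q) (integrable_of_cont (h.cont y) S)
  have gQ := h.good_pOut Q
  have gS := h.good_pOut S
  have gM := h.good_pOut (midM Q S)
  have iQ := gQ.integrable_mul_log hc gQ
  have iS := gS.integrable_mul_log hc gS
  have iM := gM.integrable_mul_log hc gM
  unfold JFun at hJ
  rw [integral_midM Q S (integrable_of_cont (h.continuous_gFun hc) Q)
    (integrable_of_cont (h.continuous_gFun hc) S)] at hJ
  set D : ℝ → ℝ := fun y => (pOut k Q y * Real.log (pOut k Q y) + pOut k S y * Real.log (pOut k S y)) / 2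
    - pOut k (midM Q S) y * Real.log (pOut k (midM Q S) y) with hD
  have iD : Integrable D := ((iQ.add iS).div_const 2).sub iM
  have hDint : ∫ y, D y = ((∫ y, pOut k Q y * Real.log (pOut k Q y)) +
      ∫ y, pOut k S y * Real.log (pOut k S y)) / 2
      - ∫ y, pOut k (midM Q S) y * Real.log (pOut k (midM Q S) y) := by
    have iA : Integrable (fun y => pOut k Q y * Real.log (pOut k Q y) +
      pOut k S y * Real.log (pOut k S y)) := iQ.add iS
    simp only [hD]
    rw [integral_sub (iA.div_const 2) iM, integral_div, integral_add iQ iS]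
  have hD0 : ∀ y, 0 ≤ D y := by
    intro y
    have := (strictConvexOn_mul_log.convexOn).2 (Set.mem_Ici.2 (gQ.pos hc y).le)
      (Set.mem_Ici.2 (gS.pos hc y).le) (show (0 : ℝ) ≤ 2⁻¹ by norm_num) (show (0 : ℝ) ≤ 2⁻¹ by norm_num) (by norm_num)
    simp only [smul_eq_mul] at this
    simp only [hD, hp]
    have e : (pOut k Q y + pOut k S y) / 2 = 2⁻¹ * pOut k Q y + 2⁻¹ * pOut k S y := by ring
    rw [e]
    linarith
  have hDz : ∫ y, D y = 0 := le_antisymm (by rw [hDint]; linarith) (integral_nonneg hD0)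
  have hDae := (integral_eq_zero_iff_of_nonneg hD0 iD).1 hDz
  filter_upwards [hDae] with y hy
  by_contra hne
  have := strictConvexOn_mul_log.2 (Set.mem_Ici.2 (gQ.pos hc y).le)
      (Set.mem_Ici.2 (gS.pos hc y).le) hne (show (0 : ℝ) < 2⁻¹ by norm_num) (show (0 : ℝ) < 2⁻¹ by norm_num) (by norm_num)
  simp only [smul_eq_mul] at this
  simp only [hD, hp, Pi.zero_apply] at hy
  have e : (pOut k Q y + pOut k S y) / 2 = 2⁻¹ * pOut k Q y + 2⁻¹ * pOut k S y := by ring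
  rw [e] at hy
  linarith

end abstractKernel

/-- Concrete channel density. -/
def kd (K m : ℝ) (w v : ℝ≥0) (x y : ℝ) : ℝ :=
  ∫ g, gaussianPDFReal 0 v (y - K * x * rexp (2 * g)) ∂(gaussianReal m w)

lemma pdf_cont (v : ℝ≥0) : Continuous (gaussianPDFReal 0 v) := by
  unfold gaussianPDFReal
  fun_prop

lemma pdf_le (v : ℝ≥0) (z : ℝ) : gaussianPDFReal 0 v z ≤ (√(2 * π * v))⁻¹ := by
  unfold gaussianPDFReal
  have : rexp (-(z - 0) ^ 2 / (2 * v)) ≤ 1 := by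
    rw [Real.exp_le_one_iff]
    apply div_nonpos_of_nonpos_of_nonneg
    · nlinarith [sq_nonneg (z - 0)]
    · positivity
  exact mul_le_of_le_one_right (by positivity) this

lemma pdf_decay (v : ℝ≥0) (hv : v ≠ 0) :
    ∃ C : ℝ, 0 ≤ C ∧ ∀ z, gaussianPDFReal 0 v z * (1 + z ^ 2) ^ 2 ≤ C := by
  have hv' : 0 < (v : ℝ) := by positivity
  refine ⟨(√(2 * π * v))⁻¹ * (8 * v ^ 2 * rexp (1 / (2 * v))), by positivity, fun z => ?_⟩
  unfold gaussianPDFReal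
  rw [mul_assoc]
  refine mul_le_mul_of_nonneg_left ?_ (by positivity)
  have h1 := Real.quadratic_le_exp_of_nonneg (x := (1 + z ^ 2) / (2 * v)) (by positivity)
  have h2 : (1 + z ^ 2) ^ 2 ≤ 8 * v ^ 2 * rexp ((1 + z ^ 2) / (2 * v)) := by
    have h3 : 0 ≤ (1 + z ^ 2) / (2 * (v : ℝ)) := by positivity
    have h4 : (1 + z ^ 2) ^ 2 = 8 * (v : ℝ) ^ 2 * (((1 + z ^ 2) / (2 * v)) ^ 2 / 2) := by
      field_simp
      ring
    rw [h4]
    gcongr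
    linarith
  calc rexp (-(z - 0) ^ 2 / (2 * v)) * (1 + z ^ 2) ^ 2
      ≤ rexp (-(z - 0) ^ 2 / (2 * v)) * (8 * v ^ 2 * rexp ((1 + z ^ 2) / (2 * v))) := by gcongr
    _ = 8 * v ^ 2 * (rexp (-(z - 0) ^ 2 / (2 * v)) * rexp ((1 + z ^ 2) / (2 * v))) := by ring
    _ = 8 * v ^ 2 * rexp (1 / (2 * v)) := by
        rw [← Real.exp_add]
        congr 2
        field_simp
        ring

lemma pdf_integrable (K m : ℝ) (w v : ℝ≥0) (x y : ℝ) :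
    Integrable (fun g => gaussianPDFReal 0 v (y - K * x * rexp (2 * g))) (gaussianReal m w) := by
  refine (integrable_const ((√(2 * π * v))⁻¹)).mono' ?_ (.of_forall fun g => ?_)
  · have := pdf_cont v
    exact (Continuous.aestronglyMeasurable (by fun_prop))
  · rw [Real.norm_eq_abs, abs_of_nonneg (gaussianPDFReal_nonneg _ _ _)]
    exact pdf_le v _

lemma kd_meas (K m : ℝ) (w v : ℝ≥0) : Measurable (Function.uncurry (kd K m w v)) := by
  have hc := pdf_cont v
  have h1 : Continuous (Function.uncurry fun (z : ℝ × ℝ) (g : ℝ) =>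
      gaussianPDFReal 0 v (z.2 - K * z.1 * rexp (2 * g))) := by
    unfold Function.uncurry
    fun_prop
  exact (h1.stronglyMeasurable.integral_prod_right (ν := gaussianReal m w)).measurable

lemma kd_cont (K m : ℝ) (w v : ℝ≥0) (y : ℝ) : Continuous fun x => kd K m w v x y := by
  have hc := pdf_cont v
  refine continuous_of_dominated (bound := fun _ => (√(2 * π * v))⁻¹) ?_ ?_ ?_ ?_
  · intro x
    exact (pdf_integrable K m w v x y).aestronglyMeasurable
  · intro x
    refine .of_forall fun g => ?_
    rw [Real.norm_eq_abs, abs_of_nonneg (gaussianPDFReal_nonneg _ _ _)]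
    exact pdf_le v _
  · exact integrable_const _
  · exact .of_forall fun g => by fun_prop

lemma kd_good (K m A : ℝ) (w v : ℝ≥0) (hv : v ≠ 0) (hK : 0 < K) :
    ∃ B c a : ℝ, 0 < c ∧ ∀ x ∈ Set.Icc 0 A, Good B c a (kd K m w v x) := by
  obtain ⟨C, hC0, hC⟩ := pdf_decay v hv
  have hv' : 0 < (v : ℝ) := by positivity
  have i1 : Integrable (fun g => 4 * C * (1 + (K * A * rexp (2 * g)) ^ 2) ^ 2) (gaussianReal m w) := by
    have e4 := integrable_exp_mul_gaussianReal (μ := m) (v := w) 4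
    have e8 := integrable_exp_mul_gaussianReal (μ := m) (v := w) 8
    have := (((integrable_const (1 : ℝ)).add (e4.const_mul (2 * K ^ 2 * A ^ 2))).add
      (e8.const_mul (K ^ 4 * A ^ 4))).const_mul (4 * C)
    refine this.congr (.of_forall fun g => ?_)
    have h4 : rexp (4 * g) = rexp (2 * g) ^ 2 := by rw [← Real.exp_nat_mul]; congr 1; push_cast; ring
    have h8 : rexp (8 * g) = rexp (2 * g) ^ 4 := by rw [← Real.exp_nat_mul]; congr 1; push_cast; ring
    simp only [Pi.add_apply, h4, h8]
    ring
  have i2 : Integrable (fun g => rexp (-((K * A * rexp (2 * g)) ^ 2 / v))) (gaussianReal m w) := by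
    refine (integrable_const (1 : ℝ)).mono' (Continuous.aestronglyMeasurable (by fun_prop))
      (.of_forall fun g => ?_)
    rw [Real.norm_eq_abs, abs_of_pos (Real.exp_pos _), Real.exp_le_one_iff]
    have : 0 ≤ (K * A * rexp (2 * g)) ^ 2 / (v : ℝ) := by positivity
    linarith
  refine ⟨∫ g, 4 * C * (1 + (K * A * rexp (2 * g)) ^ 2) ^ 2 ∂(gaussianReal m w),
    (√(2 * π * v))⁻¹ * ∫ g, rexp (-((K * A * rexp (2 * g)) ^ 2 / v)) ∂(gaussianReal m w), (v : ℝ)⁻¹,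
    mul_pos (by positivity) (integral_exp_pos i2), fun x hx => ⟨?_, fun y => ?_, fun y => ?_⟩⟩
  · exact (kd_meas K m w v).of_uncurry_left
  · rw [← integral_mul_const]
    refine integral_mono (pdf_integrable K m w v x y) (i1.mul_const _) fun g => ?_
    dsimp only
    have hu0 : 0 ≤ K * x * rexp (2 * g) := by have := hx.1; positivity
    have hu1 : K * x * rexp (2 * g) ≤ K * A * rexp (2 * g) := by have := hx.2; gcongr
    generalize K * x * rexp (2 * g) = u at hu0 hu1
    generalize K * A * rexp (2 * g) = U at hu1
    have hz := hC (y - u)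
    have hnn := gaussianPDFReal_nonneg 0 v (y - u)
    generalize gaussianPDFReal 0 v (y - u) = q at hz hnn
    rw [← div_eq_mul_inv, le_div_iff₀ (by positivity)]
    have k1 : 1 + y ^ 2 ≤ 2 * (1 + (y - u) ^ 2) * (1 + U ^ 2) := by
      have : u ^ 2 ≤ U ^ 2 := by gcongr
      have h3 : 1 + y ^ 2 ≤ 2 * (1 + (y - u) ^ 2) * (1 + u ^ 2) := by
        nlinarith [sq_nonneg (y - 2 * u), sq_nonneg ((y - u) * u)]
      refine h3.trans ?_
      gcongr
    calc q * (1 + y ^ 2) ^ 2 ≤ q * (2 * (1 + (y - u) ^ 2) * (1 + U ^ 2)) ^ 2 := by gcongr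
      _ = 4 * (q * (1 + (y - u) ^ 2) ^ 2) * (1 + U ^ 2) ^ 2 := by ring
      _ ≤ 4 * C * (1 + U ^ 2) ^ 2 := by gcongr
  · rw [← integral_const_mul, ← integral_mul_const]
    refine integral_mono ((i2.const_mul _).mul_const _) (pdf_integrable K m w v x y) fun g => ?_
    dsimp only
    have hu0 : 0 ≤ K * x * rexp (2 * g) := by have := hx.1; positivity
    have hu1 : K * x * rexp (2 * g) ≤ K * A * rexp (2 * g) := by have := hx.2; gcongr
    generalize K * x * rexp (2 * g) = u at hu0 hu1
    generalize K * A * rexp (2 * g) = U at hu1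
    unfold gaussianPDFReal
    rw [mul_assoc, ← Real.exp_add]
    gcongr
    have : u ^ 2 ≤ U ^ 2 := by gcongr
    have e1 : -(y - u - 0) ^ 2 / (2 * (v : ℝ)) - (-(U ^ 2 / v) + -((v : ℝ)⁻¹ * y ^ 2)) =
      (2 * U ^ 2 + 2 * y ^ 2 - (y - u) ^ 2) / (2 * v) := by
      field_simp
      ring
    have e2 : 0 ≤ (2 * U ^ 2 + 2 * y ^ 2 - (y - u) ^ 2) / (2 * (v : ℝ)) := by
      apply div_nonneg _ (by positivity)
      nlinarith [sq_nonneg (y + u)]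
    linarith

lemma lintegral_channelLaw (K m s sg x : ℝ) {f : ℝ → ℝ≥0∞} (hf : Measurable f) :
    ∫⁻ y, f y ∂(channelLaw K m s sg x) =
      ∫⁻ g, ∫⁻ n, f (K * x * rexp (2 * g) + n) ∂(gaussianReal 0 (Real.toNNReal (sg ^ 2)))
        ∂(gaussianReal m (Real.toNNReal (s ^ 2))) := by
  have hm : Measurable fun p : ℝ × ℝ => K * x * Real.exp (2 * p.1) + p.2 :=
    Continuous.measurable (by fun_prop)
  rw [channelLaw, lintegral_map hf hm, lintegral_prod (fun p : ℝ × ℝ => f (K * x * Real.exp (2 * p.1) + p.2))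
    (hf.comp hm).aemeasurable]

lemma channelLaw_eq (K m s sg : ℝ) (hsg : 0 < sg) (x : ℝ) :
    channelLaw K m s sg x = volume.withDensity fun y =>
      ENNReal.ofReal (kd K m (Real.toNNReal (s ^ 2)) (Real.toNNReal (sg ^ 2)) x y) := by
  set w := Real.toNNReal (s ^ 2) with hw
  set v := Real.toNNReal (sg ^ 2) with hv
  have hv0 : v ≠ 0 := by simp [hv]; exact hsg.ne'
  refine Measure.ext_of_lintegral _ fun f hf => ?_
  have mk : Measurable fun y => ENNReal.ofReal (kd K m w v x y) :=
    ((kd_meas K m w v).comp (measurable_const.prodMk measurable_id)).ennreal_ofReal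
  rw [lintegral_channelLaw K m s sg x hf, lintegral_withDensity_eq_lintegral_mul _ mk hf]
  have mpdf : Measurable (gaussianPDF 0 v) := measurable_gaussianPDF 0 v
  have h1 : ∀ g : ℝ, ∫⁻ n, f (K * x * rexp (2 * g) + n) ∂(gaussianReal 0 v) =
      ∫⁻ y, gaussianPDF 0 v (y - K * x * rexp (2 * g)) * f y := by
    intro g
    rw [gaussianReal_of_var_ne_zero _ hv0, lintegral_withDensity_eq_lintegral_mul _ mpdf (by fun_prop),
      ← lintegral_add_left_eq_self (fun y => gaussianPDF 0 v (y - K * x * rexp (2 * g)) * f y)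
        (K * x * rexp (2 * g))]
    simp
  simp_rw [← hv, ← hw, h1]
  rw [lintegral_lintegral_swap]
  · congr 1
    ext y
    rw [lintegral_mul_const _ (by fun_prop), Pi.mul_apply, kd,
      ofReal_integral_eq_lintegral_ofReal (pdf_integrable K m w v x y)
      (.of_forall fun g => gaussianPDFReal_nonneg _ _ _)]
    rfl
  · apply Measurable.aemeasurable
    unfold Function.uncurry
    fun_prop

lemma channelLaw_measurable (K m s sg : ℝ) (hsg : 0 < sg) : Measurable (channelLaw K m s sg) := by
  refine Measure.measurable_of_measurable_coe _ fun t ht => ?_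
  simp_rw [channelLaw_eq K m s sg hsg, withDensity_apply _ ht]
  exact Measurable.lintegral_prod_right (f := fun x y : ℝ => ENNReal.ofReal
    (kd K m (Real.toNNReal (s ^ 2)) (Real.toNNReal (sg ^ 2)) x y)) (kd_meas _ _ _ _).ennreal_ofReal

instance (K m s sg x : ℝ) : IsProbabilityMeasure (channelLaw K m s sg x) := by
  unfold channelLaw
  exact Measure.isProbabilityMeasure_map (Continuous.aemeasurable (by fun_prop))

/-- Law of the noiseless output. -/
def noiselessLaw (K m s : ℝ) (F : Measure ℝ) : Measure ℝ :=
  Measure.map (fun z : ℝ × ℝ => K * z.1 * rexp (2 * z.2))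
    (F.prod (gaussianReal m (Real.toNNReal (s ^ 2))))

instance (K m s : ℝ) (F : Measure ℝ) [IsProbabilityMeasure F] :
    IsProbabilityMeasure (noiselessLaw K m s F) := by
  unfold noiselessLaw
  exact Measure.isProbabilityMeasure_map (Continuous.aemeasurable (by fun_prop))

lemma outputDist_eq_conv (K m s sg : ℝ) (hsg : 0 < sg) (F : Measure ℝ) [IsProbabilityMeasure F] :
    outputDist K m s sg F =
      (noiselessLaw K m s F).conv (gaussianReal 0 (Real.toNNReal (sg ^ 2))) := by
  refine Measure.ext_of_lintegral _ fun f hf => ?_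
  have hm : Measurable (fun z : ℝ × ℝ => K * z.1 * rexp (2 * z.2)) :=
    Continuous.measurable (by fun_prop)
  have hi : Measurable fun u => ∫⁻ n, f (u + n) ∂(gaussianReal 0 (Real.toNNReal (sg ^ 2))) := by
    apply Measurable.lintegral_prod_right (f := fun u n => f (u + n))
    unfold Function.uncurry
    fun_prop
  rw [outputDist, Measure.lintegral_bind (channelLaw_measurable K m s sg hsg).aemeasurable hf.aemeasurable,
    Measure.lintegral_conv hf, noiselessLaw, lintegral_map hi hm,
    lintegral_prod (fun z : ℝ × ℝ => ∫⁻ n, f (K * z.1 * rexp (2 * z.2) + n)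
      ∂(gaussianReal 0 (Real.toNNReal (sg ^ 2)))) (hi.comp hm).aemeasurable]
  simp_rw [lintegral_channelLaw K m s sg _ hf]

lemma noiselessLaw_eq (K m s sg : ℝ) (hsg : 0 < sg) (F F' : Measure ℝ) [IsProbabilityMeasure F]
    [IsProbabilityMeasure F'] (h : outputDist K m s sg F = outputDist K m s sg F') :
    noiselessLaw K m s F = noiselessLaw K m s F' := by
  rw [outputDist_eq_conv K m s sg hsg, outputDist_eq_conv K m s sg hsg] at h
  apply Measure.ext_of_charFun
  ext t
  have := congrArg (fun μ => charFun μ t) h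
  simp only [charFun_conv] at this
  refine mul_right_cancel₀ ?_ this
  rw [charFun_gaussianReal]
  exact Complex.exp_ne_zero _

lemma moments_eq (K m s sg : ℝ) (hK : 0 < K) (hsg : 0 < sg) (F F' : Measure ℝ)
    [IsProbabilityMeasure F] [IsProbabilityMeasure F']
    (h : outputDist K m s sg F = outputDist K m s sg F') (n : ℕ) :
    ∫ x, x ^ n ∂F = ∫ x, x ^ n ∂F' := by
  have key : ∀ F : Measure ℝ, IsProbabilityMeasure F → ∫ u, u ^ n ∂(noiselessLaw K m s F) =
      (∫ x, x ^ n ∂F) * ∫ g, K ^ n * rexp ((2 * n) * g) ∂(gaussianReal m (Real.toNNReal (s ^ 2))) := by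
    intro F _
    rw [noiselessLaw, integral_map (Continuous.aemeasurable (by fun_prop))
      (Continuous.aestronglyMeasurable (by fun_prop)), ← integral_prod_mul]
    congr 1
    ext z
    have : rexp (2 * n * z.2) = rexp (2 * z.2) ^ n := by
      rw [← Real.exp_nat_mul]; congr 1; ring
    rw [this]
    ring
  have h1 := key F inferInstance
  rw [noiselessLaw_eq K m s sg hsg F F' h, key F' inferInstance] at h1
  refine (mul_right_cancel₀ ?_ h1).symm
  rw [integral_const_mul]
  have := integral_exp_pos (integrable_exp_mul_gaussianReal (μ := m) (v := Real.toNNReal (s ^ 2)) (2 * n))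
  positivity

lemma ext_of_moments (A : ℝ) (Q S : Measure (Set.Icc (0 : ℝ) A)) [IsProbabilityMeasure Q]
    [IsProbabilityMeasure S]
    (h : ∀ n : ℕ, ∫ x : Set.Icc (0 : ℝ) A, (x : ℝ) ^ n ∂Q = ∫ x : Set.Icc (0 : ℝ) A, (x : ℝ) ^ n ∂S) : Q = S := by
  have hpoly : ∀ p : Polynomial ℝ, ∫ x : Set.Icc (0 : ℝ) A, p.eval (x : ℝ) ∂Q =
      ∫ x : Set.Icc (0 : ℝ) A, p.eval (x : ℝ) ∂S := by
    intro p
    simp_rw [Polynomial.eval_eq_sum_range]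
    rw [integral_finsetSum _ fun i _ => integrable_of_cont (by fun_prop) Q,
      integral_finsetSum _ fun i _ => integrable_of_cont (by fun_prop) S]
    simp_rw [integral_const_mul, h]
  apply ext_of_forall_integral_eq_of_IsFiniteMeasure
  intro f
  apply eq_of_forall_dist_le
  intro ε hε
  obtain ⟨p, hp⟩ := exists_polynomial_near_continuousMap 0 A f.toContinuousMap (ε / 2) (by positivity)
  have hpt : ∀ x : Set.Icc (0 : ℝ) A, ‖f x - p.eval (x : ℝ)‖ ≤ ε / 2 := by
    intro x
    have := (ContinuousMap.norm_coe_le_norm (p.toContinuousMapOn _ - f.toContinuousMap) x).trans hp.le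
    rw [← norm_neg]
    simpa using this
  have hb : ∀ T : Measure (Set.Icc (0 : ℝ) A), IsProbabilityMeasure T →
      |(∫ x, f x ∂T) - ∫ x : Set.Icc (0 : ℝ) A, p.eval (x : ℝ) ∂T| ≤ ε / 2 := by
    intro T _
    have hpc : Continuous fun x : Set.Icc (0 : ℝ) A => p.eval (x : ℝ) :=
      p.continuous.comp continuous_subtype_val
    rw [← integral_sub (integrable_of_cont f.continuous T) (integrable_of_cont hpc T), ← Real.norm_eq_abs]
    simpa using norm_integral_le_of_norm_le_const (μ := T) (.of_forall hpt)
  have h1 := hb Q inferInstance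
  have h2 := hb S inferInstance
  rw [hpoly p] at h1
  rw [abs_le] at h1 h2
  rw [Real.dist_eq, abs_le]
  constructor <;> linarith [h1.1, h1.2, h2.1, h2.2]

/-- The pushforward of a measure on the interval to the line. -/
def up {A : ℝ} (Q : Measure (Set.Icc (0 : ℝ) A)) : Measure ℝ := Q.map Subtype.val

instance {A : ℝ} (Q : Measure (Set.Icc (0 : ℝ) A)) [IsProbabilityMeasure Q] :
    IsProbabilityMeasure (up Q) :=
  Measure.isProbabilityMeasure_map measurable_subtype_coe.aemeasurable

lemma integral_up {A : ℝ} (Q : Measure (Set.Icc (0 : ℝ) A)) (f : ℝ → ℝ) :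
    ∫ x, f x ∂(up Q) = ∫ x : Set.Icc (0 : ℝ) A, f x ∂Q :=
  (MeasurableEmbedding.subtype_coe measurableSet_Icc).integral_map f

lemma exists_up {A : ℝ} (F : Measure ℝ) [IsProbabilityMeasure F] (hF : F (Set.Icc 0 A)ᶜ = 0) :
    ∃ Q : Measure (Set.Icc (0 : ℝ) A), IsProbabilityMeasure Q ∧ up Q = F := by
  have h : up (F.comap (Subtype.val : Set.Icc (0 : ℝ) A → ℝ)) = F := by
    unfold up
    rw [map_comap_subtype_coe measurableSet_Icc, Measure.restrict_eq_self_of_ae_mem]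
    exact hF
  refine ⟨F.comap Subtype.val, ?_, h⟩
  constructor
  have h2 : up (F.comap (Subtype.val : Set.Icc (0 : ℝ) A → ℝ)) Set.univ = 1 := by rw [h]; simp
  rwa [up, Measure.map_apply measurable_subtype_coe MeasurableSet.univ, Set.preimage_univ] at h2

/-- The kernel density restricted to the interval. -/
def kI (K m s sg A : ℝ) (x : Set.Icc (0 : ℝ) A) (y : ℝ) : ℝ :=
  kd K m (Real.toNNReal (s ^ 2)) (Real.toNNReal (sg ^ 2)) x y

lemma kI_goodK (K m s sg A : ℝ) (hK : 0 < K) (hsg : 0 < sg) :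
    ∃ B c a : ℝ, 0 < c ∧ GoodK B c a (kI K m s sg A) := by
  have hv0 : Real.toNNReal (sg ^ 2) ≠ 0 := by simp; exact hsg.ne'
  obtain ⟨B, c, a, hc, h⟩ := kd_good K m A (Real.toNNReal (s ^ 2)) (Real.toNNReal (sg ^ 2)) hv0 hK
  refine ⟨B, c, a, hc, ?_, ?_, fun x => h x x.2, ?_⟩
  · have h1 : Measurable fun z : Set.Icc (0 : ℝ) A × ℝ => ((z.1 : ℝ), z.2) := by fun_prop
    have h2 : Function.uncurry (kI K m s sg A) =
        Function.uncurry (kd K m (Real.toNNReal (s ^ 2)) (Real.toNNReal (sg ^ 2))) ∘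
          fun z : Set.Icc (0 : ℝ) A × ℝ => ((z.1 : ℝ), z.2) := by
      ext ⟨x, y⟩
      simp only [Function.comp_apply, Function.uncurry_apply_pair, kI]
    rw [h2]
    exact Measurable.comp (kd_meas K m (Real.toNNReal (s ^ 2)) (Real.toNNReal (sg ^ 2))) h1
  · intro y
    exact (kd_cont K m (Real.toNNReal (s ^ 2)) (Real.toNNReal (sg ^ 2)) y).comp continuous_subtype_val
  · intro x
    have hg := h x x.2
    have h1 : channelLaw K m s sg x Set.univ = 1 := measure_univ
    rw [channelLaw_eq K m s sg hsg, withDensity_apply _ MeasurableSet.univ, Measure.restrict_univ,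
      ← ofReal_integral_eq_lintegral_ofReal (hg.integrable hc) (.of_forall fun y => (hg.pos hc y).le)] at h1
    exact ENNReal.ofReal_eq_one.1 h1

lemma outputDist_up (K m s sg A : ℝ) (hK : 0 < K) (hsg : 0 < sg) (Q : Measure (Set.Icc (0 : ℝ) A))
    [IsProbabilityMeasure Q] :
    outputDist K m s sg (up Q) = volume.withDensity fun y => ENNReal.ofReal (pOut (kI K m s sg A) Q y) := by
  obtain ⟨B, c, a, hc, h⟩ := kI_goodK K m s sg A hK hsg
  refine Measure.ext fun t ht => ?_
  rw [outputDist, Measure.bind_apply ht (channelLaw_measurable K m s sg hsg).aemeasurable,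
    withDensity_apply _ ht, up,
    (MeasurableEmbedding.subtype_coe measurableSet_Icc).lintegral_map]
  have e : ∀ x : Set.Icc (0 : ℝ) A, channelLaw K m s sg x t =
      ∫⁻ y in t, ENNReal.ofReal (kI K m s sg A x y) := by
    intro x
    rw [channelLaw_eq K m s sg hsg, withDensity_apply _ ht]
    rfl
  simp_rw [e]
  rw [lintegral_lintegral_swap]
  · congr 1
    ext y
    rw [pOut, ofReal_integral_eq_lintegral_ofReal (integrable_of_cont (h.cont y) Q)
      (.of_forall fun x => ((h.good x).pos hc y).le)]
  · exact h.meas.ennreal_ofReal.aemeasurable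

lemma mutualInfo_up (K m s sg A : ℝ) (hK : 0 < K) (hsg : 0 < sg) (Q : Measure (Set.Icc (0 : ℝ) A))
    [IsProbabilityMeasure Q] :
    mutualInfo K m s sg (up Q) = ENNReal.ofReal (JFun (kI K m s sg A) Q) := by
  obtain ⟨B, c, a, hc, h⟩ := kI_goodK K m s sg A hK hsg
  rw [← (h.lintegral_klR hc Q).1, mutualInfo, up,
    (MeasurableEmbedding.subtype_coe measurableSet_Icc).lintegral_map, ← up]
  congr 1
  ext x
  rw [infoDensity, outputDist_up K m s sg A hK hsg, channelLaw_eq K m s sg hsg]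
  exact klDiv'_withDensity hc (h.good x) (h.good_pOut Q)

lemma feasible_up (A ε b c Eth : ℝ) (Q : Measure (Set.Icc (0 : ℝ) A)) [IsProbabilityMeasure Q] :
    feasible A ε b c Eth (up Q) ↔ (∫ x : Set.Icc (0 : ℝ) A, (x : ℝ) ∂Q) ≤ ε ∧
      Eth ≤ ∫ x : Set.Icc (0 : ℝ) A, b * x * Real.log (1 + c * x) ∂Q := by
  unfold feasible
  rw [integral_up, integral_up]
  have h0 : up Q (Set.Icc 0 A)ᶜ = 0 := by
    rw [up, Measure.map_apply measurable_subtype_coe measurableSet_Icc.compl]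
    convert measure_empty (μ := Q)
    ext x
    simp only [Set.mem_preimage, Set.mem_compl_iff, Set.mem_empty_iff_false, iff_false, not_not]
    exact x.2
  exact ⟨fun h => h.2.2, fun h => ⟨inferInstance, h0, h⟩⟩

lemma cont_energy (A b c : ℝ) (hc : 0 < c) :
    Continuous fun x : Set.Icc (0 : ℝ) A => b * (x : ℝ) * Real.log (1 + c * x) := by
  refine Continuous.mul (by fun_prop) (Continuous.log (by fun_prop) fun x => ?_)
  have := mul_nonneg hc.le x.2.1
  linarith

/-- there exists a unique probability measure `F* ∈ Ω` achieving the
capacity, i.e. `I(F*) = sup_{F ∈ Ω} I(F) = C` (assuming `Ω` nonempty and `C` finite). -/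
theorem capacity_achieved_by_unique_distribution
    (K m s sg A ε b c Eth : ℝ)
    (hK : 0 < K) (hs : 0 < s) (hsg : 0 < sg) (hA : 0 < A) (hε : 0 < ε)
    (hb : 0 < b) (hc : 0 < c) (hE : 0 ≤ Eth)
    (hne : ∃ F : Measure ℝ, feasible A ε b c Eth F)
    (hCfin : capacity K m s sg A ε b c Eth ≠ ⊤) :
    ∃! F : Measure ℝ, feasible A ε b c Eth F ∧
      mutualInfo K m s sg F = capacity K m s sg A ε b c Eth := by
  obtain ⟨B, c', a, hc', hk⟩ := kI_goodK K m s sg A hK hsg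
  have ce := cont_energy A b c hc
  let I := Set.Icc (0 : ℝ) A
  let T : Set (ProbabilityMeasure I) := {Q | (∫ x : I, (x : ℝ) ∂(Q : Measure I)) ≤ ε ∧
      Eth ≤ ∫ x : I, b * x * Real.log (1 + c * x) ∂(Q : Measure I)}
  have hTc : IsClosed T := by
    apply IsClosed.inter
    · exact isClosed_le (ProbabilityMeasure.continuous_integral_continuousMap
        (⟨fun x : I => (x : ℝ), continuous_subtype_val⟩ : C(I, ℝ))) continuous_const
    · exact isClosed_le continuous_const (ProbabilityMeasure.continuous_integral_continuousMap
        (⟨_, ce⟩ : C(I, ℝ)))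
  have hTne : T.Nonempty := by
    obtain ⟨F, hF⟩ := hne
    have := hF.1
    obtain ⟨Q, hQ, rfl⟩ := exists_up F hF.2.1
    exact ⟨⟨Q, hQ⟩, (feasible_up A ε b c Eth Q).1 hF⟩
  obtain ⟨Q, hQT, hQmax⟩ := hTc.isCompact.exists_isMaxOn hTne (hk.continuous_JFun hc').continuousOn
  have hfeas : feasible A ε b c Eth (up (Q : Measure I)) := (feasible_up A ε b c Eth _).2 hQT
  have hmax : ∀ S : Measure I, IsProbabilityMeasure S → feasible A ε b c Eth (up S) →
      JFun (kI K m s sg A) S ≤ JFun (kI K m s sg A) Q := by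
    intro S hS hfS
    exact hQmax (a := ⟨S, hS⟩) ((feasible_up A ε b c Eth S).1 hfS)
  have hcap : mutualInfo K m s sg (up (Q : Measure I)) = capacity K m s sg A ε b c Eth := by
    apply le_antisymm
    · exact le_iSup₂_of_le (up (Q : Measure I)) hfeas le_rfl
    · refine iSup₂_le fun F hF => ?_
      have hF' : feasible A ε b c Eth F := hF
      have := hF'.1
      obtain ⟨S, hS, rfl⟩ := exists_up F hF'.2.1
      rw [mutualInfo_up K m s sg A hK hsg, mutualInfo_up K m s sg A hK hsg]
      exact ENNReal.ofReal_le_ofReal (hmax S hS hF')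
  refine ⟨up (Q : Measure I), ⟨hfeas, hcap⟩, ?_⟩
  rintro F ⟨hF, hFcap⟩
  have := hF.1
  obtain ⟨S, hS, rfl⟩ := exists_up F hF.2.1
  congr 1
  have hJ : JFun (kI K m s sg A) S = JFun (kI K m s sg A) Q := by
    rw [← hcap, mutualInfo_up K m s sg A hK hsg, mutualInfo_up K m s sg A hK hsg] at hFcap
    exact (ENNReal.ofReal_eq_ofReal_iff (hk.lintegral_klR hc' S).2
      (hk.lintegral_klR hc' (Q : Measure I)).2).1 hFcap
  have hfm : feasible A ε b c Eth (up (midM S (Q : Measure I))) := by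
    rw [feasible_up] at hF hfeas ⊢
    rw [integral_midM S (Q : Measure I) (integrable_of_cont continuous_subtype_val _)
      (integrable_of_cont continuous_subtype_val _),
      integral_midM S (Q : Measure I) (integrable_of_cont ce _) (integrable_of_cont ce _)]
    constructor <;> linarith [hF.1, hF.2, hfeas.1, hfeas.2]
  have hae := hk.strict hc' S (Q : Measure I) (by
    have := hmax _ inferInstance hfm
    linarith)
  have hout : outputDist K m s sg (up S) = outputDist K m s sg (up (Q : Measure I)) := by
    rw [outputDist_up K m s sg A hK hsg, outputDist_up K m s sg A hK hsg]
    apply withDensity_congr_ae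
    filter_upwards [hae] with y hy
    rw [hy]
  apply ext_of_moments
  intro n
  have := moments_eq K m s sg hK hsg _ _ hout n
  rwa [integral_up, integral_up] at this
end
end

section
/- Strong duality holds for the capacity problem: assuming there exists a strictly feasible F₀ (a probability measure on [0,A] with ∫ x dF₀(x) < ε and ∫ b·x·ln(1+c·x) dF₀(x) > E_th) and C is finite, there exist constants λ₁ ≥ 0 and λ₂ ≥ 0 such that C = sup over all probability measures F on [0, A] of [ I(F) − λ₁·(∫ x dF(x) − ε) − λ₂·(E_th − ∫ b·x·ln(1 + c·x) dF(x)) ]. -/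
open MeasureTheory ProbabilityTheory Real ENNReal NNReal

noncomputable section
open scoped Classical

lemma channelLaw_meas_fun (K x : ℝ) :
    Measurable (fun p : ℝ × ℝ => K * x * Real.exp (2 * p.1) + p.2) := by
  fun_prop

lemma measurable_channelLaw (K m s sg : ℝ) : Measurable (channelLaw K m s sg) := by
  refine Measure.measurable_of_measurable_coe _ fun t ht => ?_
  have h1 : Measurable (fun q : ℝ × (ℝ × ℝ) => K * q.1 * Real.exp (2 * q.2.1) + q.2.2) := by
    fun_prop
  have h2 := measurable_measure_prodMk_left
    (ν := (gaussianReal m (Real.toNNReal (s ^ 2))).prod (gaussianReal 0 (Real.toNNReal (sg ^ 2))))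
    (h1 ht)
  convert h2 using 2 with x
  rw [channelLaw, Measure.map_apply (channelLaw_meas_fun K x) ht]
  rfl

instance isProb_channelLaw (K m s sg x : ℝ) : IsProbabilityMeasure (channelLaw K m s sg x) :=
  Measure.isProbabilityMeasure_map (channelLaw_meas_fun K x).aemeasurable

lemma toNNReal_sq_ne {s : ℝ} (hs : 0 < s) : Real.toNNReal (s ^ 2) ≠ 0 := by
  simp only [ne_eq, Real.toNNReal_eq_zero, not_le]; positivity

lemma channelLaw_zero_iff (K m s sg x : ℝ) (hsg : 0 < sg) {t : Set ℝ}
    (ht : MeasurableSet t) : channelLaw K m s sg x t = 0 ↔ volume t = 0 := by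
  rw [channelLaw, Measure.map_apply (channelLaw_meas_fun K x) ht,
    Measure.prod_apply (channelLaw_meas_fun K x ht)]
  have key : ∀ u : ℝ, gaussianReal 0 (Real.toNNReal (sg ^ 2))
      (Prod.mk u ⁻¹' ((fun p : ℝ × ℝ => K * x * Real.exp (2 * p.1) + p.2) ⁻¹' t)) = 0
      ↔ volume t = 0 := by
    intro u
    have e : (Prod.mk u ⁻¹' ((fun p : ℝ × ℝ => K * x * Real.exp (2 * p.1) + p.2) ⁻¹' t))
      = (fun v => K * x * Real.exp (2 * u) + v) ⁻¹' t := rfl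
    rw [e, ← measure_preimage_add volume (K * x * Real.exp (2 * u)) t]
    exact ⟨fun h => gaussianReal_absolutelyContinuous' 0 (toNNReal_sq_ne hsg) h,
      fun h => gaussianReal_absolutelyContinuous 0 (toNNReal_sq_ne hsg) h⟩
  constructor
  · intro h
    rw [lintegral_eq_zero_iff (measurable_measure_prodMk_left (channelLaw_meas_fun K x ht))] at h
    obtain ⟨u, hu⟩ := h.exists
    exact (key u).1 hu
  · intro h
    simp [fun u => (key u).2 h]

instance isProb_outputDist (K m s sg : ℝ) (F : Measure ℝ) [IsProbabilityMeasure F] :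
    IsProbabilityMeasure (outputDist K m s sg F) := by
  constructor
  rw [outputDist, Measure.bind_apply MeasurableSet.univ (measurable_channelLaw K m s sg).aemeasurable]
  simp

lemma outputDist_zero_iff (K m s sg : ℝ) (hsg : 0 < sg) (F : Measure ℝ) [IsProbabilityMeasure F]
    {t : Set ℝ} (ht : MeasurableSet t) : outputDist K m s sg F t = 0 ↔ volume t = 0 := by
  have hm := measurable_channelLaw K m s sg
  have hm' : Measurable fun a => channelLaw K m s sg a t := (Measure.measurable_coe ht).comp hm
  rw [outputDist, Measure.bind_apply ht hm.aemeasurable,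
    lintegral_eq_zero_iff hm']
  constructor
  · intro h
    obtain ⟨u, hu⟩ := h.exists
    exact (channelLaw_zero_iff K m s sg u hsg ht).1 hu
  · intro h
    exact Filter.Eventually.of_forall fun u => (channelLaw_zero_iff K m s sg u hsg ht).2 h

lemma channelLaw_ac (K m s sg x : ℝ) (hsg : 0 < sg) (F : Measure ℝ) [IsProbabilityMeasure F] :
    channelLaw K m s sg x ≪ outputDist K m s sg F :=
  Measure.AbsolutelyContinuous.mk fun _ ht h =>
    (channelLaw_zero_iff K m s sg x hsg ht).2 ((outputDist_zero_iff K m s sg hsg F ht).1 h)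

lemma outputDist_ac (K m s sg : ℝ) (hsg : 0 < sg) (F G : Measure ℝ) [IsProbabilityMeasure F]
    [IsProbabilityMeasure G] : outputDist K m s sg F ≪ outputDist K m s sg G :=
  Measure.AbsolutelyContinuous.mk fun _ ht h =>
    (outputDist_zero_iff K m s sg hsg F ht).2 ((outputDist_zero_iff K m s sg hsg G ht).1 h)

lemma llr_add_llr {μ Q P : Measure ℝ} [IsProbabilityMeasure μ] [IsProbabilityMeasure Q]
    [IsProbabilityMeasure P] (h1 : μ ≪ Q) (h2 : Q ≪ P) :
    llr μ P =ᵐ[μ] fun y => llr μ Q y + llr Q P y := by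
  filter_upwards [(h1.trans h2) (Measure.rnDeriv_mul_rnDeriv (κ := P) h1),
    Measure.rnDeriv_pos h1, h1 (Measure.rnDeriv_pos h2), h1 (μ.rnDeriv_lt_top Q),
    (h1.trans h2) (Q.rnDeriv_lt_top P)] with y e p1 p2 t1 t2
  rw [llr_def, llr_def, llr_def]
  simp only
  rw [← e, Pi.mul_apply, ENNReal.toReal_mul, Real.log_mul]
  · exact (ENNReal.toReal_pos p1.ne' t1.ne).ne'
  · exact (ENNReal.toReal_pos p2.ne' t2.ne).ne'

lemma integral_llr_nonneg' {μ Q : Measure ℝ} [IsProbabilityMeasure μ] [IsProbabilityMeasure Q]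
    (h1 : μ ≪ Q) (hi : Integrable (llr μ Q) μ) : 0 ≤ ∫ y, llr μ Q y ∂μ := by
  have := InformationTheory.integral_llr_add_sub_measure_univ_nonneg h1 hi
  simpa using this

lemma kl_step {μ Q P : Measure ℝ} [IsProbabilityMeasure μ] [IsProbabilityMeasure Q]
    [IsProbabilityMeasure P] (h1 : μ ≪ Q) (h2 : Q ≪ P) (hi : Integrable (llr Q P) μ) :
    klDiv' μ P + ∫⁻ y, ENNReal.ofReal (-llr Q P y) ∂μ
      = klDiv' μ Q + ∫⁻ y, ENNReal.ofReal (llr Q P y) ∂μ := by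
  have hadd := llr_add_llr h1 h2
  have f1 : ∫⁻ y, ENNReal.ofReal (llr Q P y) ∂μ ≠ ⊤ := hi.lintegral_lt_top.ne
  have f2 : ∫⁻ y, ENNReal.ofReal (-llr Q P y) ∂μ ≠ ⊤ := hi.neg.lintegral_lt_top.ne
  by_cases hQ : Integrable (llr μ Q) μ
  · have hP : Integrable (llr μ P) μ := (integrable_congr hadd).2 (hQ.add hi)
    have n1 := integral_llr_nonneg' h1 hQ
    have n2 := integral_llr_nonneg' (h1.trans h2) hP
    rw [klDiv', klDiv', if_pos ⟨h1.trans h2, hP⟩, if_pos ⟨h1, hQ⟩]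
    have e := integral_eq_lintegral_pos_part_sub_lintegral_neg_part hi
    have e2 : ∫ y, llr μ P y ∂μ = ∫ y, llr μ Q y ∂μ + ∫ y, llr Q P y ∂μ := by
      rw [integral_congr_ae hadd, integral_add hQ hi]
    rw [← ENNReal.toReal_eq_toReal_iff' (by finiteness) (by finiteness),
      ENNReal.toReal_add (by finiteness) (by finiteness),
      ENNReal.toReal_add (by finiteness) (by finiteness),
      ENNReal.toReal_ofReal n1, ENNReal.toReal_ofReal n2]
    linarith
  · have hP : ¬ Integrable (llr μ P) μ := by
      intro hP
      apply hQ
      have h3 := ((integrable_congr hadd).1 hP).sub hi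
      refine h3.congr (Filter.Eventually.of_forall fun y => ?_)
      simp
    rw [klDiv', klDiv', if_neg (fun h => hP h.2), if_neg (fun h => hQ h.2)]
    simp

/-- bounded density implies integrable log-likelihood ratio -/
lemma integrable_llr_of_le {Q P : Measure ℝ} [IsProbabilityMeasure Q] [IsProbabilityMeasure P]
    (h2 : Q ≪ P) {k : ℝ≥0} (hk : Q ≤ k • P) : Integrable (llr Q P) Q := by
  have hb : Q.rnDeriv P ≤ᵐ[P] fun _ => (k : ℝ≥0∞) := by
    refine ae_le_of_forall_setLIntegral_le_of_sigmaFinite (Q.measurable_rnDeriv P) fun t _ _ => ?_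
    rw [setLIntegral_const]
    exact (Measure.setLIntegral_rnDeriv_le t).trans (hk t)
  rw [← integrable_rnDeriv_mul_log_iff h2]
  obtain ⟨B, hB⟩ := (isCompact_Icc (a := (0 : ℝ)) (b := k)).exists_bound_of_continuousOn
    (Real.continuous_mul_log.continuousOn)
  refine Integrable.of_bound (C := B) ?_ ?_
  · refine Measurable.aestronglyMeasurable ?_
    have := (Q.measurable_rnDeriv P).ennreal_toReal
    exact this.mul (Real.measurable_log.comp this)
  · filter_upwards [hb] with y hy
    exact hB _ ⟨ENNReal.toReal_nonneg, by simpa using ENNReal.toReal_mono (by simp) hy⟩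

/-- replacing the true output distribution by another one increases the average divergence. -/
lemma mutualInfo_le (K m s sg : ℝ) (hsg : 0 < sg) (F G : Measure ℝ) [IsProbabilityMeasure F]
    [IsProbabilityMeasure G] {k : ℝ≥0}
    (hk : outputDist K m s sg F ≤ k • outputDist K m s sg G) :
    mutualInfo K m s sg F ≤ ∫⁻ x, infoDensity K m s sg G x ∂F := by
  have hm := measurable_channelLaw K m s sg
  set Q := outputDist K m s sg F with hQ
  set P := outputDist K m s sg G with hP
  have hQP : Q ≪ P := outputDist_ac K m s sg hsg F G
  have hi : Integrable (llr Q P) Q := integrable_llr_of_le hQP hk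
  have hL := measurable_llr Q P
  have m1 : Measurable fun y => ENNReal.ofReal (llr Q P y) := hL.ennreal_ofReal
  have m2 : Measurable fun y => ENNReal.ofReal (-llr Q P y) := hL.neg.ennreal_ofReal
  have mm1 : Measurable fun x => ∫⁻ y, ENNReal.ofReal (llr Q P y) ∂(channelLaw K m s sg x) :=
    (Measure.measurable_lintegral m1).comp hm
  have mm2 : Measurable fun x => ∫⁻ y, ENNReal.ofReal (-llr Q P y) ∂(channelLaw K m s sg x) :=
    (Measure.measurable_lintegral m2).comp hm
  have i1 : ∫⁻ x, ∫⁻ y, ENNReal.ofReal (llr Q P y) ∂(channelLaw K m s sg x) ∂F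
      = ∫⁻ y, ENNReal.ofReal (llr Q P y) ∂Q :=
    (Measure.lintegral_bind hm.aemeasurable m1.aemeasurable).symm
  have i2 : ∫⁻ x, ∫⁻ y, ENNReal.ofReal (-llr Q P y) ∂(channelLaw K m s sg x) ∂F
      = ∫⁻ y, ENNReal.ofReal (-llr Q P y) ∂Q :=
    (Measure.lintegral_bind hm.aemeasurable m2.aemeasurable).symm
  have f1 : ∫⁻ y, ENNReal.ofReal (llr Q P y) ∂Q ≠ ⊤ := hi.lintegral_lt_top.ne
  have f2 : ∫⁻ y, ENNReal.ofReal (-llr Q P y) ∂Q ≠ ⊤ := hi.neg.lintegral_lt_top.ne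
  have hle : ∫⁻ y, ENNReal.ofReal (-llr Q P y) ∂Q ≤ ∫⁻ y, ENNReal.ofReal (llr Q P y) ∂Q := by
    have e := integral_eq_lintegral_pos_part_sub_lintegral_neg_part hi
    have := integral_llr_nonneg' hQP hi
    rw [← ENNReal.toReal_le_toReal f2 f1]
    linarith
  have a1 : ∀ᵐ x ∂F, ∫⁻ y, ENNReal.ofReal (llr Q P y) ∂(channelLaw K m s sg x) < ⊤ :=
    ae_lt_top mm1 (by rw [i1]; exact f1)
  have a2 : ∀ᵐ x ∂F, ∫⁻ y, ENNReal.ofReal (-llr Q P y) ∂(channelLaw K m s sg x) < ⊤ :=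
    ae_lt_top mm2 (by rw [i2]; exact f2)
  have hstep : ∀ᵐ x ∂F, infoDensity K m s sg G x
        + ∫⁻ y, ENNReal.ofReal (-llr Q P y) ∂(channelLaw K m s sg x)
      = infoDensity K m s sg F x
        + ∫⁻ y, ENNReal.ofReal (llr Q P y) ∂(channelLaw K m s sg x) := by
    filter_upwards [a1, a2] with x h1 h2
    refine kl_step (channelLaw_ac K m s sg x hsg F) hQP ⟨hL.aestronglyMeasurable, ?_⟩
    rw [hasFiniteIntegral_iff_norm]
    calc ∫⁻ y, ENNReal.ofReal ‖llr Q P y‖ ∂(channelLaw K m s sg x)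
        ≤ ∫⁻ y, (ENNReal.ofReal (llr Q P y) + ENNReal.ofReal (-llr Q P y))
            ∂(channelLaw K m s sg x) := by
          refine lintegral_mono fun y => ?_
          rcases le_total 0 (llr Q P y) with h | h
          · rw [Real.norm_of_nonneg h]; exact le_self_add
          · rw [Real.norm_of_nonpos h]; exact le_add_self
      _ < ⊤ := by
          rw [lintegral_add_left m1]
          exact ENNReal.add_lt_top.2 ⟨h1, h2⟩
  have htot := lintegral_congr_ae hstep
  rw [lintegral_add_right _ mm2, lintegral_add_right _ mm1, i1, i2] at htot
  have : mutualInfo K m s sg F + ∫⁻ y, ENNReal.ofReal (-llr Q P y) ∂Q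
      ≤ (∫⁻ x, infoDensity K m s sg G x ∂F) + ∫⁻ y, ENNReal.ofReal (-llr Q P y) ∂Q := by
    rw [htot, mutualInfo]
    gcongr
  exact (ENNReal.add_le_add_iff_right f2).1 this

lemma isProb_mix {F G : Measure ℝ} [IsProbabilityMeasure F] [IsProbabilityMeasure G]
    {t u : ℝ≥0} (h : t + u = 1) : IsProbabilityMeasure (t • F + u • G) := by
  constructor
  simp only [Measure.coe_add, Pi.add_apply, Measure.smul_apply, measure_univ]
  rw [ENNReal.smul_def, ENNReal.smul_def, smul_eq_mul, smul_eq_mul, mul_one, mul_one]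
  exact_mod_cast h

lemma outputDist_mix (K m s sg : ℝ) (F G : Measure ℝ) (t u : ℝ≥0) :
    outputDist K m s sg (t • F + u • G)
      = t • outputDist K m s sg F + u • outputDist K m s sg G := by
  have hm := measurable_channelLaw K m s sg
  ext a ha
  simp only [outputDist, Measure.coe_add, Pi.add_apply, Measure.smul_apply,
    Measure.bind_apply ha hm.aemeasurable, lintegral_add_measure, lintegral_smul_measure]

lemma le_smul_inv {Q P : Measure ℝ} {t : ℝ≥0} (ht : t ≠ 0) (h : t • Q ≤ P) : Q ≤ t⁻¹ • P := by
  have : t⁻¹ • (t • Q) ≤ t⁻¹ • P := by gcongr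
  rwa [smul_smul, inv_mul_cancel₀ ht, one_smul] at this

lemma mutualInfo_concave (K m s sg : ℝ) (hsg : 0 < sg) (F G : Measure ℝ)
    [IsProbabilityMeasure F] [IsProbabilityMeasure G] {t u : ℝ≥0} (h : t + u = 1) :
    t * mutualInfo K m s sg F + u * mutualInfo K m s sg G
      ≤ mutualInfo K m s sg (t • F + u • G) := by
  have := isProb_mix (F := F) (G := G) h
  have e : mutualInfo K m s sg (t • F + u • G)
      = t * ∫⁻ x, infoDensity K m s sg (t • F + u • G) x ∂F
        + u * ∫⁻ x, infoDensity K m s sg (t • F + u • G) x ∂G := by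
    rw [mutualInfo, lintegral_add_measure, lintegral_smul_measure, lintegral_smul_measure]
    simp only [ENNReal.smul_def, smul_eq_mul]
  rw [e]
  refine add_le_add ?_ ?_
  · rcases eq_or_ne t 0 with rfl | ht
    · simp
    · refine mul_le_mul_right (mutualInfo_le K m s sg hsg F _ (k := t⁻¹) (le_smul_inv ht ?_)) _
      rw [outputDist_mix]
      exact le_add_of_nonneg_right (Measure.zero_le _)
  · rcases eq_or_ne u 0 with rfl | ht
    · simp
    · refine mul_le_mul_right (mutualInfo_le K m s sg hsg G _ (k := u⁻¹) (le_smul_inv ht ?_)) _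
      rw [outputDist_mix]
      exact le_add_of_nonneg_left (Measure.zero_le _)

lemma integrable_of_cont_s1 {A : ℝ} {F : Measure ℝ} [IsProbabilityMeasure F]
    (hF : F (Set.Icc 0 A)ᶜ = 0) {f : ℝ → ℝ} (hf : ContinuousOn f (Set.Icc 0 A)) :
    Integrable f F := by
  have h := hf.integrableOn_compact (μ := F) isCompact_Icc
  rw [IntegrableOn, Measure.restrict_eq_self_of_ae_mem] at h
  · exact h
  · exact mem_ae_iff.2 hF

lemma integral_mix {F G : Measure ℝ} {f : ℝ → ℝ} (hF : Integrable f F) (hG : Integrable f G)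
    (t u : ℝ≥0) : ∫ x, f x ∂(t • F + u • G) = t * ∫ x, f x ∂F + u * ∫ x, f x ∂G := by
  rw [integral_add_measure, integral_smul_nnreal_measure, integral_smul_nnreal_measure]
  · simp [NNReal.smul_def]
  · exact hF.smul_measure_nnreal
  · exact hG.smul_measure_nnreal

lemma abstract_duality {ι : Type*} (I g1 g2 : ι → ℝ) (C : ℝ)
    (hconv : ∀ (F G : ι) (t u : ℝ), 0 ≤ t → 0 ≤ u → t + u = 1 → ∃ H : ι,
      t * I F + u * I G ≤ I H ∧ g1 H ≤ t * g1 F + u * g1 G ∧ g2 H ≤ t * g2 F + u * g2 G)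
    (hC : ∀ F, g1 F ≤ 0 → g2 F ≤ 0 → I F ≤ C)
    (hS : ∃ F, g1 F < 0 ∧ g2 F < 0) :
    ∃ l₁ l₂ : ℝ, 0 ≤ l₁ ∧ 0 ≤ l₂ ∧ ∀ F, I F - (l₁ * g1 F + l₂ * g2 F) ≤ C := by
  obtain ⟨F₀, hF1, hF2⟩ := hS
  let S : Set (ℝ × ℝ × ℝ) := ⋃ F : ι, (Set.Ioi (g1 F) ×ˢ (Set.Ioi (g2 F) ×ˢ Set.Iio (I F)))
  have memS : ∀ x y z : ℝ, (x, y, z) ∈ S ↔ ∃ F, g1 F < x ∧ g2 F < y ∧ z < I F := by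
    intro x y z
    simp [S]
  have hopen : IsOpen S := isOpen_iUnion fun F => isOpen_Ioi.prod (isOpen_Ioi.prod isOpen_Iio)
  have lin : ∀ {a a' c c' t u : ℝ}, 0 ≤ t → 0 ≤ u → t + u = 1 → a < a' → c < c' →
      t * a + u * c < t * a' + u * c' := by
    intro a a' c c' t u ht hu htu h1 h2
    rcases ht.eq_or_lt with rfl | ht
    · have : u = 1 := by linarith
      subst this; linarith
    · have := mul_lt_mul_of_pos_left h1 ht
      have := mul_le_mul_of_nonneg_left h2.le hu
      linarith
  have hcvx : Convex ℝ S := by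
    rintro ⟨x, y, z⟩ h1 ⟨x', y', z'⟩ h2 t u ht hu htu
    obtain ⟨F, a1, a2, a3⟩ := (memS _ _ _).1 h1
    obtain ⟨G, b1, b2, b3⟩ := (memS _ _ _).1 h2
    obtain ⟨H, c1, c2, c3⟩ := hconv F G t u ht hu htu
    refine (memS _ _ _).2 ⟨H, ?_, ?_, ?_⟩
    · exact c2.trans_lt (lin ht hu htu a1 b1)
    · exact c3.trans_lt (lin ht hu htu a2 b2)
    · exact (lin ht hu htu a3 b3).trans_le c1
  have hnot : ((0 : ℝ), (0 : ℝ), C) ∉ S := by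
    intro h
    obtain ⟨F, a1, a2, a3⟩ := (memS _ _ _).1 h
    exact absurd (hC F a1.le a2.le) (not_le.2 a3)
  obtain ⟨f, hf⟩ := geometric_hahn_banach_open_point hcvx hopen hnot
  set p := f (1, 0, 0) with hp
  set q := f (0, 1, 0) with hq
  set d := f (0, 0, 1) with hd
  have hfe : ∀ x y z : ℝ, f (x, y, z) = p * x + q * y + d * z := by
    intro x y z
    have : (x, y, z) = x • ((1 : ℝ), (0 : ℝ), (0 : ℝ)) + y • ((0 : ℝ), (1 : ℝ), (0 : ℝ))
        + z • ((0 : ℝ), (0 : ℝ), (1 : ℝ)) := by simp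
    rw [this, map_add, map_add, map_smul, map_smul, map_smul]
    simp only [smul_eq_mul]
    ring
  have key : ∀ F x y z, g1 F < x → g2 F < y → z < I F → p * x + q * y + d * z < d * C := by
    intro F x y z h1 h2 h3
    have := hf _ ((memS x y z).2 ⟨F, h1, h2, h3⟩)
    rw [hfe, hfe] at this
    linarith
  -- a linear function bounded above along a ray has nonpositive slope
  have slope : ∀ a M : ℝ, (∀ T : ℝ, 0 < T → a * T < M) → a ≤ 0 := by
    intro a M h
    by_contra! ha
    have hT : 0 < (|M| + 1) / a := by positivity
    have := h _ hT
    rw [mul_div_cancel₀ _ ha.ne'] at this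
    linarith [le_abs_self M]
  have hp0 : p ≤ 0 := slope p (d * C - (q * 0 + d * (I F₀ - 1))) fun T hT => by
    have := key F₀ T 0 (I F₀ - 1) (by linarith) hF2 (by linarith)
    linarith
  have hq0 : q ≤ 0 := slope q (d * C - (p * 0 + d * (I F₀ - 1))) fun T hT => by
    have := key F₀ 0 T (I F₀ - 1) hF1 (by linarith) (by linarith)
    linarith
  have hd0 : 0 ≤ d := by
    have := slope (-d) (d * C - d * I F₀) fun T hT => by
      have := key F₀ 0 0 (I F₀ - T) hF1 hF2 (by linarith)
      linarith
    linarith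
  have hdpos : 0 < d := by
    rcases hd0.eq_or_lt with h | h
    · have := key F₀ 0 0 (I F₀ - 1) hF1 hF2 (by linarith)
      rw [← h] at this
      simp at this
    · exact h
  have lim : ∀ F, p * g1 F + q * g2 F + d * I F ≤ d * C := by
    intro F
    refine le_of_forall_pos_lt_add fun e he => ?_
    have hs : 0 < d - p - q := by linarith
    have h := key F (g1 F + e / (d - p - q)) (g2 F + e / (d - p - q)) (I F - e / (d - p - q))
      (by linarith [div_pos he hs]) (by linarith [div_pos he hs]) (by linarith [div_pos he hs])
    have h2 : (d - p - q) * (e / (d - p - q)) = e := mul_div_cancel₀ _ hs.ne'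
    nlinarith
  refine ⟨-p / d, -q / d, div_nonneg (by linarith) hd0, div_nonneg (by linarith) hd0, fun F => ?_⟩
  have h := lim F
  have e : I F - (-p / d * g1 F + -q / d * g2 F) = (p * g1 F + q * g2 F + d * I F) / d := by
    field_simp
    ring
  rw [e, div_le_iff₀ hdpos]
  linarith

/-- strong duality for the capacity problem. Assuming a strictly
feasible `F₀` exists and `C` is finite, there are `λ₁, λ₂ ≥ 0` such that
`C = sup_F [ I(F) − λ₁(∫x dF − ε) − λ₂(E_th − ∫ b x ln(1+cx) dF) ]`, the supremum
being over all probability measures `F` on `[0, A]`. -/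
theorem strong_duality
    (K m s sg A ε b c Eth : ℝ)
    (hK : 0 < K) (hs : 0 < s) (hsg : 0 < sg) (hA : 0 < A) (hε : 0 < ε)
    (hb : 0 < b) (hc : 0 < c) (hE : 0 ≤ Eth)
    (hSlater : ∃ F₀ : Measure ℝ, IsProbabilityMeasure F₀ ∧ F₀ (Set.Icc 0 A)ᶜ = 0 ∧
      (∫ x, x ∂F₀) < ε ∧ Eth < ∫ x, b * x * Real.log (1 + c * x) ∂F₀)
    (hCfin : capacity K m s sg A ε b c Eth ≠ ⊤) :
    ∃ l₁ l₂ : ℝ, 0 ≤ l₁ ∧ 0 ≤ l₂ ∧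
      (capacity K m s sg A ε b c Eth : EReal) =
        ⨆ F ∈ {F : Measure ℝ | IsProbabilityMeasure F ∧ F (Set.Icc 0 A)ᶜ = 0},
          ((mutualInfo K m s sg F : EReal) -
            ((l₁ * ((∫ x, x ∂F) - ε) +
              l₂ * (Eth - ∫ x, b * x * Real.log (1 + c * x) ∂F) : ℝ) : EReal)) := by
  obtain ⟨F₀, hF₀, hF₀s, hF₀1, hF₀2⟩ := hSlater
  set g : ℝ → ℝ := fun x => b * x * Real.log (1 + c * x) with hg
  have hgc : ContinuousOn g (Set.Icc 0 A) := by
    refine ContinuousOn.mul (by fun_prop) (ContinuousOn.log (by fun_prop) fun x hx => ?_)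
    have := mul_nonneg hc.le hx.1
    linarith
  have hid : ContinuousOn (fun x : ℝ => x) (Set.Icc 0 A) := by fun_prop
  set C := capacity K m s sg A ε b c Eth with hCdef
  have hle : ∀ F, feasible A ε b c Eth F → mutualInfo K m s sg F ≤ C := fun F hF =>
    le_iSup₂ (f := fun F (_ : F ∈ {F : Measure ℝ | feasible A ε b c Eth F}) =>
      mutualInfo K m s sg F) F hF
  have hmixs : ∀ (F G : Measure ℝ) (t u : ℝ≥0), F (Set.Icc 0 A)ᶜ = 0 → G (Set.Icc 0 A)ᶜ = 0 →
      (t • F + u • G) (Set.Icc 0 A)ᶜ = 0 := by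
    intro F G t u h1 h2
    simp only [Measure.coe_add, Pi.add_apply, Measure.smul_apply, h1, h2, smul_zero, add_zero]
  -- finiteness of the mutual information on all of `[0, A]`
  have hfin : ∀ F : Measure ℝ, IsProbabilityMeasure F → F (Set.Icc 0 A)ᶜ = 0 →
      mutualInfo K m s sg F ≠ ⊤ := by
    intro F hF hFs htop
    have c1 : Filter.Tendsto (fun t : ℝ => t * (∫ x, x ∂F) + (1 - t) * ∫ x, x ∂F₀)
        (nhdsWithin 0 (Set.Ioi 0)) (nhds (∫ x, x ∂F₀)) := by
      have : Continuous (fun t : ℝ => t * (∫ x, x ∂F) + (1 - t) * ∫ x, x ∂F₀) := by fun_prop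
      simpa using (this.tendsto 0).mono_left nhdsWithin_le_nhds
    have c2 : Filter.Tendsto (fun t : ℝ => t * (∫ x, g x ∂F) + (1 - t) * ∫ x, g x ∂F₀)
        (nhdsWithin 0 (Set.Ioi 0)) (nhds (∫ x, g x ∂F₀)) := by
      have : Continuous (fun t : ℝ => t * (∫ x, g x ∂F) + (1 - t) * ∫ x, g x ∂F₀) := by fun_prop
      simpa using (this.tendsto 0).mono_left nhdsWithin_le_nhds
    obtain ⟨t, h1, h2, h3⟩ := ((c1.eventually_lt_const hF₀1).and
      ((c2.eventually_const_lt hF₀2).and (Ioo_mem_nhdsGT (zero_lt_one' ℝ)))).exists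
    obtain ⟨h3, h4⟩ := h3
    lift t to ℝ≥0 using h3.le
    obtain ⟨u, hu⟩ : ∃ u : ℝ≥0, (u : ℝ) = 1 - t := ⟨⟨1 - t, by linarith⟩, rfl⟩
    have htu : t + u = 1 := by
      apply NNReal.coe_injective
      push_cast
      rw [hu]; ring
    have hp := isProb_mix (F := F) (G := F₀) htu
    have hfe : feasible A ε b c Eth (t • F + u • F₀) := by
      refine ⟨hp, hmixs F F₀ t u hFs hF₀s, ?_, ?_⟩
      · rw [integral_mix (integrable_of_cont_s1 hFs hid) (integrable_of_cont_s1 hF₀s hid), hu]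
        exact h1.le
      · rw [integral_mix (f := g) (integrable_of_cont_s1 hFs hgc) (integrable_of_cont_s1 hF₀s hgc), hu]
        exact h2.le
    have h5 := (mutualInfo_concave K m s sg hsg F F₀ htu).trans (hle _ hfe)
    rw [htop, ENNReal.mul_top (by exact_mod_cast h3.ne'), top_add] at h5
    exact hCfin (top_le_iff.1 h5)
  obtain ⟨l₁, l₂, hl₁, hl₂, hl⟩ := abstract_duality
    (ι := {F : Measure ℝ // IsProbabilityMeasure F ∧ F (Set.Icc 0 A)ᶜ = 0})
    (fun F => (mutualInfo K m s sg F.1).toReal) (fun F => (∫ x, x ∂F.1) - ε)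
    (fun F => Eth - ∫ x, g x ∂F.1) C.toReal
    (by
      rintro ⟨F, hF, hFs⟩ ⟨G, hG, hGs⟩ t u ht hu htu
      lift t to ℝ≥0 using ht
      lift u to ℝ≥0 using hu
      have htu' : t + u = 1 := by exact_mod_cast htu
      have hp := isProb_mix (F := F) (G := G) htu'
      refine ⟨⟨t • F + u • G, hp, hmixs F G t u hFs hGs⟩, ?_, ?_, ?_⟩
      · have h5 := ENNReal.toReal_mono (hfin _ hp (hmixs F G t u hFs hGs))
          (mutualInfo_concave K m s sg hsg F G htu')
        rw [ENNReal.toReal_add (ENNReal.mul_ne_top (by simp) (hfin F hF hFs))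
          (ENNReal.mul_ne_top (by simp) (hfin G hG hGs)), ENNReal.toReal_mul,
          ENNReal.toReal_mul] at h5
        exact h5
      · simp only
        rw [integral_mix (integrable_of_cont_s1 hFs hid) (integrable_of_cont_s1 hGs hid)]
        apply le_of_eq
        linear_combination (-ε) * htu.symm
      · simp only
        rw [integral_mix (f := g) (integrable_of_cont_s1 hFs hgc) (integrable_of_cont_s1 hGs hgc)]
        apply le_of_eq
        linear_combination Eth * htu.symm)
    (by
      rintro ⟨F, hF, hFs⟩ h1 h2
      exact ENNReal.toReal_mono hCfin (hle F ⟨hF, hFs, by simpa using h1, by simpa using h2⟩))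
    ⟨⟨F₀, hF₀, hF₀s⟩, by simpa using hF₀1, by simpa using hF₀2⟩
  refine ⟨l₁, l₂, hl₁, hl₂, le_antisymm ?_ ?_⟩
  · rw [hCdef, capacity]
    have hgoal : ∀ F, feasible A ε b c Eth F → ((mutualInfo K m s sg F : ℝ≥0∞) : EReal) ≤
        ⨆ F ∈ {F : Measure ℝ | IsProbabilityMeasure F ∧ F (Set.Icc 0 A)ᶜ = 0},
          ((mutualInfo K m s sg F : EReal) -
            ((l₁ * ((∫ x, x ∂F) - ε) + l₂ * (Eth - ∫ x, g x ∂F) : ℝ) : EReal)) := by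
      rintro F ⟨hF, hFs, h1, h2⟩
      refine le_trans ?_ (le_iSup₂ (f := fun F
        (_ : F ∈ {F : Measure ℝ | IsProbabilityMeasure F ∧ F (Set.Icc 0 A)ᶜ = 0}) =>
          ((mutualInfo K m s sg F : EReal) -
            ((l₁ * ((∫ x, x ∂F) - ε) + l₂ * (Eth - ∫ x, g x ∂F) : ℝ) : EReal))) F ⟨hF, hFs⟩)
      have h3 : l₁ * ((∫ x, x ∂F) - ε) + l₂ * (Eth - ∫ x, g x ∂F) ≤ 0 := by
        have a1 := mul_nonneg hl₁ (sub_nonneg.2 h1)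
        have a2 : 0 ≤ l₂ * ((∫ x, g x ∂F) - Eth) := mul_nonneg hl₂ (sub_nonneg.2 h2)
        linarith
      have h4 : (mutualInfo K m s sg F : EReal) - ((0 : ℝ) : EReal) ≤
          (mutualInfo K m s sg F : EReal) -
            ((l₁ * ((∫ x, x ∂F) - ε) + l₂ * (Eth - ∫ x, g x ∂F) : ℝ) : EReal) :=
        EReal.sub_le_sub le_rfl (EReal.coe_le_coe_iff.2 h3)
      simpa using h4
    generalize (⨆ F ∈ {F : Measure ℝ | IsProbabilityMeasure F ∧ F (Set.Icc 0 A)ᶜ = 0},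
          ((mutualInfo K m s sg F : EReal) -
            ((l₁ * ((∫ x, x ∂F) - ε) + l₂ * (Eth - ∫ x, g x ∂F) : ℝ) : EReal))) = S at hgoal ⊢
    have hfe₀ : feasible A ε b c Eth F₀ := ⟨hF₀, hF₀s, hF₀1.le, hF₀2.le⟩
    have hS : 0 ≤ S := (EReal.coe_ennreal_nonneg _).trans (hgoal F₀ hfe₀)
    rw [← EReal.coe_toENNReal hS, EReal.coe_ennreal_le_coe_ennreal_iff]
    refine iSup₂_le fun F hF => ?_
    rw [← EReal.coe_ennreal_le_coe_ennreal_iff, EReal.coe_toENNReal hS]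
    exact hgoal F hF
  · refine iSup₂_le fun F hF => ?_
    have h1 := hl ⟨F, hF⟩
    have h2 : (mutualInfo K m s sg F : EReal) = ((mutualInfo K m s sg F).toReal : EReal) :=
      (EReal.coe_ennreal_toReal (hfin F hF.1 hF.2)).symm
    have h3 : (C : EReal) = ((C.toReal : ℝ) : EReal) := (EReal.coe_ennreal_toReal hCfin).symm
    rw [h2, h3, ← EReal.coe_sub, EReal.coe_le_coe_iff]
    exact h1
end
end

section
/- Sufficient pointwise optimality condition: let F* ∈ Ω. If there exist constants λ₁ ≥ 0 and λ₂ ≥ 0 such that for all x ∈ [0, A], λ₁·(x − ε) − λ₂·(b·x·ln(1 + c·x) − E_th) + I(F*) − i(x; F*) ≥ 0, with equality for every x ∈ Supp(F*), then F* is the capacity-achieving input distribution, i.e., I(F*) = C = sup_{F ∈ Ω} I(F). -/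
open MeasureTheory ProbabilityTheory Real ENNReal NNReal

noncomputable section
open scoped Classical

/-- The support of a measure: points all of whose open neighborhoods have
positive measure. -/
def msupport (F : Measure ℝ) : Set ℝ :=
  {x | ∀ U : Set ℝ, IsOpen U → x ∈ U → 0 < F U}

open InformationTheory in
/-- Conditional form of the KL divergence between two composition-products. -/
lemma klDiv_compProd_right_eq_lintegral (μ : Measure ℝ) [IsProbabilityMeasure μ]
    (κ η : Kernel ℝ ℝ) [IsMarkovKernel κ] [IsMarkovKernel η]
    (h_ac : ∀ᵐ a ∂μ, κ a ≪ η a) :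
    klDiv (μ.compProd κ) (μ.compProd η) = ∫⁻ a, klDiv (κ a) (η a) ∂μ := by
  have hac2 : μ.compProd κ ≪ μ.compProd η := Measure.AbsolutelyContinuous.compProd_right h_ac
  have hmeas : Measurable (fun p : ℝ × ℝ => Kernel.rnDeriv κ η p.1 p.2) :=
    Kernel.measurable_rnDeriv κ η
  have hwd : μ.compProd κ
      = (μ.compProd η).withDensity (fun p : ℝ × ℝ => Kernel.rnDeriv κ η p.1 p.2) := by
    ext s hs
    rw [withDensity_apply _ hs, Measure.compProd_apply hs, ← lintegral_indicator hs,
      Measure.lintegral_compProd (hmeas.indicator hs)]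
    refine lintegral_congr_ae ?_
    filter_upwards [h_ac] with a ha
    rw [← Kernel.setLIntegral_rnDeriv ha (measurable_prodMk_left hs),
      ← lintegral_indicator (measurable_prodMk_left hs)]
    rfl
  have hrn : (μ.compProd κ).rnDeriv (μ.compProd η) =ᵐ[μ.compProd η]
      fun p : ℝ × ℝ => Kernel.rnDeriv κ η p.1 p.2 := by
    conv_lhs => rw [hwd]
    exact Measure.rnDeriv_withDensity _ hmeas
  rw [klDiv_eq_lintegral_klFun_of_ac hac2]
  have h1 : ∫⁻ p, ENNReal.ofReal
        (klFun ((μ.compProd κ).rnDeriv (μ.compProd η) p).toReal) ∂(μ.compProd η)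
      = ∫⁻ p, ENNReal.ofReal (klFun (Kernel.rnDeriv κ η p.1 p.2).toReal) ∂(μ.compProd η) := by
    refine lintegral_congr_ae ?_
    filter_upwards [hrn] with p hp
    rw [hp]
  rw [h1, Measure.lintegral_compProd]
  · refine lintegral_congr_ae ?_
    filter_upwards [h_ac] with a ha
    rw [klDiv_eq_lintegral_klFun_of_ac ha]
    refine lintegral_congr_ae ?_
    filter_upwards [Kernel.rnDeriv_eq_rnDeriv_measure (κ := κ) (η := η) (a := a)] with y hy
    rw [hy]
  · exact (measurable_klFun.comp hmeas.ennreal_toReal).ennreal_ofReal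

open InformationTheory in
lemma klDiv_map_swap (μ ν : Measure (ℝ × ℝ)) [IsFiniteMeasure μ] [IsFiniteMeasure ν] :
    klDiv (μ.map Prod.swap) (ν.map Prod.swap) = klDiv μ ν := by
  refine le_antisymm (klDiv_map_le _ _ measurable_swap) ?_
  have h := klDiv_map_le (μ.map Prod.swap) (ν.map Prod.swap) (measurable_swap (α := ℝ) (β := ℝ))
  rwa [Measure.map_map measurable_swap measurable_swap,
    Measure.map_map measurable_swap measurable_swap, Prod.swap_swap_eq, Measure.map_id,
    Measure.map_id] at h

open InformationTheory in
/-- The output law minimises the average divergence (compensation identity). -/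
lemma lintegral_klDiv_comp_le (μ : Measure ℝ) [IsProbabilityMeasure μ]
    (κ : Kernel ℝ ℝ) [IsMarkovKernel κ] (Q : Measure ℝ) [IsProbabilityMeasure Q]
    (h_ac : ∀ᵐ a ∂μ, κ a ≪ Q) :
    ∫⁻ a, klDiv (κ a) (μ.bind κ) ∂μ ≤ ∫⁻ a, klDiv (κ a) Q ∂μ := by
  have key : ∀ R : Measure ℝ, IsProbabilityMeasure R →
      klDiv (μ.compProd κ) (μ.prod R)
        = klDiv ((μ.bind κ).compProd (posterior κ μ)) (R.compProd (Kernel.const ℝ μ)) := by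
    intro R hR
    rw [compProd_posterior_eq_map_swap, Measure.compProd_const,
      ← Measure.prod_swap (μ := μ) (ν := R), klDiv_map_swap]
  -- absolute continuity w.r.t. the output law
  have h1 : μ.compProd κ ≪ μ.prod Q := by
    rw [← Measure.compProd_const]
    exact Measure.AbsolutelyContinuous.compProd_right (by simpa using h_ac)
  have h2 : (μ.bind κ).compProd (posterior κ μ) ≪ Q.compProd (Kernel.const ℝ μ) := by
    rw [compProd_posterior_eq_map_swap, Measure.compProd_const, ← Measure.prod_swap]
    exact h1.map measurable_swap
  have h3 := (Measure.absolutelyContinuous_compProd_iff.mp h2).2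
  have h_ac' : ∀ᵐ a ∂μ, κ a ≪ μ.bind κ := by
    have h4 := h3.map (measurable_swap (α := ℝ) (β := ℝ))
    rw [compProd_posterior_eq_map_swap, Measure.compProd_const, Measure.prod_swap,
      Measure.map_map measurable_swap measurable_swap, Prod.swap_swap_eq, Measure.map_id,
      ← Measure.compProd_const, Measure.absolutelyContinuous_compProd_right_iff] at h4
    simpa using h4
  have e1 := klDiv_compProd_right_eq_lintegral μ κ (Kernel.const ℝ Q) (by simpa using h_ac)
  have e2 := klDiv_compProd_right_eq_lintegral μ κ (Kernel.const ℝ (μ.bind κ))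
    (by simpa using h_ac')
  simp only [Kernel.const_apply, Measure.compProd_const] at e1 e2
  rw [← e1, ← e2, key _ inferInstance, key _ inferInstance,
    klDiv_compProd_eq_add (μ.bind κ) Q]
  exact le_add_self

/-- The channel as a Markov kernel. -/
def chanKernel (K m s sg : ℝ) : Kernel ℝ ℝ where
  toFun := channelLaw K m s sg
  measurable' := by
    refine Measure.measurable_of_measurable_coe _ fun t ht => ?_
    have hf : Measurable (fun q : ℝ × (ℝ × ℝ) => K * q.1 * Real.exp (2 * q.2.1) + q.2.2) := by
      fun_prop
    have := measurable_measure_prodMk_left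
      (ν := (gaussianReal m (Real.toNNReal (s ^ 2))).prod (gaussianReal 0 (Real.toNNReal (sg ^ 2))))
      (hf ht)
    convert this using 2 with x
    rw [channelLaw, Measure.map_apply (by fun_prop) ht]
    rfl

instance (K m s sg : ℝ) : IsMarkovKernel (chanKernel K m s sg) where
  isProbabilityMeasure x := by
    change IsProbabilityMeasure (channelLaw K m s sg x)
    unfold channelLaw
    exact Measure.isProbabilityMeasure_map (by fun_prop)

lemma klDiv'_eq (μ ν : Measure ℝ) [IsProbabilityMeasure μ] [IsProbabilityMeasure ν] :
    klDiv' μ ν = InformationTheory.klDiv μ ν := by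
  rw [klDiv', InformationTheory.klDiv_def]
  simp

/-- sufficient pointwise optimality condition. If `F* ∈ Ω` and there
are `λ₁, λ₂ ≥ 0` with
`λ₁(x − ε) − λ₂(b x ln(1+cx) − E_th) + I(F*) − i(x;F*) ≥ 0` for all `x ∈ [0, A]`,
with equality for every `x ∈ Supp(F*)`, then `I(F*) = C`. -/
theorem pointwise_condition_implies_optimal
    (K m s sg A ε b c Eth : ℝ)
    (hK : 0 < K) (hs : 0 < s) (hsg : 0 < sg) (hA : 0 < A) (hε : 0 < ε)
    (hb : 0 < b) (hc : 0 < c) (hE : 0 ≤ Eth)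
    (Fstar : Measure ℝ) (hFstar : feasible A ε b c Eth Fstar)
    (l₁ l₂ : ℝ) (hl₁ : 0 ≤ l₁) (hl₂ : 0 ≤ l₂)
    (hineq : ∀ x ∈ Set.Icc (0 : ℝ) A,
      0 ≤ ((l₁ * (x - ε) - l₂ * (b * x * Real.log (1 + c * x) - Eth) : ℝ) : EReal) +
            (mutualInfo K m s sg Fstar : EReal) -
            (infoDensity K m s sg Fstar x : EReal))
    (heq : ∀ x ∈ msupport Fstar,
      ((l₁ * (x - ε) - l₂ * (b * x * Real.log (1 + c * x) - Eth) : ℝ) : EReal) +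
          (mutualInfo K m s sg Fstar : EReal) -
          (infoDensity K m s sg Fstar x : EReal) = 0) :
    mutualInfo K m s sg Fstar = capacity K m s sg A ε b c Eth := by
  obtain ⟨hP, hsupp, h1, h2⟩ := hFstar
  refine le_antisymm
    (le_iSup₂_of_le (f := fun F (_ : F ∈ {F : Measure ℝ | feasible A ε b c Eth F}) =>
      mutualInfo K m s sg F) Fstar ⟨hP, hsupp, h1, h2⟩ le_rfl) ?_
  by_cases htop : mutualInfo K m s sg Fstar = ⊤
  · rw [htop]; exact le_top
  refine iSup₂_le fun F hF => ?_
  obtain ⟨hFP, hFs, hF1, hF2⟩ := hF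
  set M := mutualInfo K m s sg Fstar with hM
  obtain ⟨r, hr⟩ : ∃ r : ℝ≥0, M = r := ⟨M.toNNReal, (ENNReal.coe_toNNReal htop).symm⟩
  set g : ℝ → ℝ := fun x => l₁ * (x - ε) - l₂ * (b * x * Real.log (1 + c * x) - Eth) with hg
  -- pointwise bound
  have hpt : ∀ x ∈ Set.Icc (0 : ℝ) A, infoDensity K m s sg Fstar x ≠ ⊤ ∧
      (infoDensity K m s sg Fstar x).toReal ≤ g x + r := by
    intro x hx
    have h := hineq x hx
    rw [hr] at h
    have hne : infoDensity K m s sg Fstar x ≠ ⊤ := by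
      intro ht
      rw [ht] at h
      have e : (((r : ℝ≥0) : ℝ≥0∞) : EReal) = ((r : ℝ) : EReal) := rfl
      rw [e, ← EReal.coe_add, EReal.coe_ennreal_top] at h
      simp at h
    refine ⟨hne, ?_⟩
    obtain ⟨t, ht⟩ : ∃ t : ℝ≥0, infoDensity K m s sg Fstar x = t :=
      ⟨_, (ENNReal.coe_toNNReal hne).symm⟩
    rw [ht] at h ⊢
    have e : (((r : ℝ≥0) : ℝ≥0∞) : EReal) = ((r : ℝ) : EReal) := rfl
    have e' : (((t : ℝ≥0) : ℝ≥0∞) : EReal) = ((t : ℝ) : EReal) := rfl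
    rw [e, e', ← EReal.coe_add, ← EReal.coe_sub, ← EReal.coe_zero, EReal.coe_le_coe_iff] at h
    simp only [ENNReal.coe_toReal]
    simp only [hg]
    linarith
  have hae : ∀ᵐ x ∂F, x ∈ Set.Icc (0 : ℝ) A := by
    rw [ae_iff]; exact hFs
  have hQ : ∀ G : Measure ℝ, outputDist K m s sg G = G.bind (chanKernel K m s sg) :=
    fun G => rfl
  have hprob : ∀ G : Measure ℝ, IsProbabilityMeasure G →
      IsProbabilityMeasure (outputDist K m s sg G) := by
    intro G hG
    rw [hQ]; infer_instance
  have hinfo : ∀ G : Measure ℝ, IsProbabilityMeasure G → ∀ x, infoDensity K m s sg G x =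
      InformationTheory.klDiv (chanKernel K m s sg x) (outputDist K m s sg G) := by
    intro G hG x
    have := hprob G hG
    exact klDiv'_eq (chanKernel K m s sg x) _
  have hPQ := hprob Fstar hP
  have hle : mutualInfo K m s sg F ≤ ∫⁻ x, infoDensity K m s sg Fstar x ∂F := by
    rw [mutualInfo]
    simp_rw [hinfo F hFP, hinfo Fstar hP]
    rw [hQ F]
    refine lintegral_klDiv_comp_le F (chanKernel K m s sg) _ ?_
    filter_upwards [hae] with x hx
    have := (hpt x hx).1
    rw [hinfo Fstar hP] at this
    exact (InformationTheory.klDiv_ne_top_iff.mp this).1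
  refine hle.trans ?_
  -- integrability
  have hrestr : F.restrict (Set.Icc 0 A) = F := Measure.restrict_eq_self_of_ae_mem hae
  have hint : ∀ f : ℝ → ℝ, ContinuousOn f (Set.Icc 0 A) → Integrable f F := by
    intro f hf
    have := hf.integrableOn_Icc (μ := F)
    rwa [IntegrableOn, hrestr] at this
  have hi1 : Integrable (fun x : ℝ => x) F := hint _ continuousOn_id
  have hi2 : Integrable (fun x : ℝ => b * x * Real.log (1 + c * x)) F := by
    refine hint _ (ContinuousOn.mul (by fun_prop) (ContinuousOn.log (by fun_prop) ?_))
    intro x hx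
    have := mul_nonneg hc.le hx.1
    positivity
  have hi3 : Integrable (fun x => l₁ * (x - ε)) F :=
    (hi1.sub (integrable_const ε)).const_mul l₁
  have hi4 : Integrable (fun x => l₂ * (b * x * Real.log (1 + c * x) - Eth)) F :=
    (hi2.sub (integrable_const Eth)).const_mul l₂
  have hig : Integrable g F := hi3.sub hi4
  have hgi : ∫ x, g x ∂F ≤ 0 := by
    simp only [hg]
    rw [integral_sub hi3 hi4, integral_const_mul, integral_const_mul,
      integral_sub hi1 (integrable_const _), integral_sub hi2 (integrable_const _)]
    simp only [integral_const, probReal_univ, one_smul]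
    nlinarith [mul_nonneg hl₁ (sub_nonneg.2 hF1), mul_nonneg hl₂ (sub_nonneg.2 hF2)]
  calc ∫⁻ x, infoDensity K m s sg Fstar x ∂F
      ≤ ∫⁻ x, ENNReal.ofReal (g x + r) ∂F := by
        refine lintegral_mono_ae ?_
        filter_upwards [hae] with x hx
        rw [← ENNReal.ofReal_toReal (hpt x hx).1]
        exact ENNReal.ofReal_le_ofReal (hpt x hx).2
    _ = ENNReal.ofReal (∫ x, (g x + r) ∂F) := by
        rw [ofReal_integral_eq_lintegral_ofReal (f := fun x => g x + r)
          (hig.add (integrable_const _))]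
        filter_upwards [hae] with x hx
        exact ENNReal.toReal_nonneg.trans (hpt x hx).2
    _ ≤ ENNReal.ofReal r := by
        refine ENNReal.ofReal_le_ofReal ?_
        rw [integral_add hig (integrable_const _)]
        simp only [integral_const, probReal_univ, one_smul]
        linarith
    _ = M := by rw [hr, ENNReal.ofReal_coe_nnreal]
end
end
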